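/- arXiv:1502.07531 — 5 statements merged into one kernel-verified Lean document; each statement's English description precedes it below -/
import Mathlib

section
/- Let d ∈ ℕ, α̃ > 0, δ > 0, β, μ, η ∈ ℝ^d and let Δ be a symmetric positive definite d×d matrix such that α̃² > ⟨β + η', Δ(β + η')⟩ for every η' ∈ R_η (in particular α̃² > ⟨β, Δβ⟩). For ξ ∈ ℝ^d and η' ∈ R_η set u := ξ − iη' ∈ ℂ^d and define A(u) = i⟨u,μ⟩ − δ( √(α̃² − ⟨β,Δβ⟩) − sqrt( α̃² − ⟨β + iu, Δ(β + iu)⟩ ) ), where ⟨z,w⟩ = Σ_j z_j w_j is the bilinear pairing on ℂ^d and sqrt denotes the principal branch of the complex square root (the radicand equals α̃² − ⟨β+η', Δ(β+η')⟩ + ⟨ξ, Δξ⟩ − 2i⟨β+η', Δξ⟩ and has strictly positive real part under the hypothesis). Then there exist constants C, G > 0 and G' ≥ 0 such that for all ξ ∈ ℝ^d and η' ∈ R_η: |A(ξ − iη')| ≤ C(1+|ξ|) and Re A(ξ − iη') ≥ G(1+|ξ|) − G'. -/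
open MeasureTheory Real Complex Set

/-- The box of weights between `0` and `η` componentwise. -/
def Rbox {d : ℕ} (η : EuclideanSpace ℝ (Fin d)) : Set (EuclideanSpace ℝ (Fin d)) :=
  {η' | ∀ j, η' j ∈ Set.uIcc 0 (η j)}

/-- The bilinear pairing `⟨z,w⟩ = ∑ z_j w_j` on `ℂ^d`. -/
noncomputable def cpair {d : ℕ} (z w : Fin d → ℂ) : ℂ := ∑ j, z j * w j

/-- The symbol of the multivariate NIG process with parameters `(α̃, β, δ, μ, Δ)`:
`A(u) = i⟨u,μ⟩ − δ(√(α̃² − ⟨β,Δβ⟩) − sqrt(α̃² − ⟨β+iu, Δ(β+iu)⟩))`, where `sqrt`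
is the principal branch of the complex square root (`z ^ (1/2)` via `cpow`). -/
noncomputable def nigSymbol {d : ℕ} (at_ δ : ℝ) (β μ : EuclideanSpace ℝ (Fin d))
    (Δ : Matrix (Fin d) (Fin d) ℝ) (u : Fin d → ℂ) : ℂ :=
  Complex.I * cpair u (fun j => (μ j : ℂ)) -
    (δ : ℂ) * (((Real.sqrt (at_ ^ 2 - ∑ j, ∑ k, β j * Δ j k * β k) : ℝ) : ℂ) -
      ((at_ ^ 2 : ℂ) - ∑ j, ∑ k, ((β j : ℂ) + Complex.I * u j) * (Δ j k : ℂ) *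
        ((β k : ℂ) + Complex.I * u k)) ^ (1 / 2 : ℂ))


/-- real bilinear form of the matrix -/
noncomputable def nigB {d : ℕ} (Δ : Matrix (Fin d) (Fin d) ℝ) (x y : EuclideanSpace ℝ (Fin d)) : ℝ :=
  ∑ j, ∑ k, x j * Δ j k * y k

lemma nigB_abs_le {d : ℕ} (Δ : Matrix (Fin d) (Fin d) ℝ) (x y : EuclideanSpace ℝ (Fin d)) :
    |nigB Δ x y| ≤ (∑ j, ∑ k, |Δ j k|) * (‖x‖ * ‖y‖) := by
  unfold nigB
  rw [Finset.sum_mul]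
  refine (Finset.abs_sum_le_sum_abs _ _).trans (Finset.sum_le_sum fun j _ => ?_)
  rw [Finset.sum_mul]
  refine (Finset.abs_sum_le_sum_abs _ _).trans (Finset.sum_le_sum fun k _ => ?_)
  have h1 : |x j| ≤ ‖x‖ := PiLp.norm_apply_le x j
  have h2 : |y k| ≤ ‖y‖ := PiLp.norm_apply_le y k
  rw [abs_mul, abs_mul]
  calc |x j| * |Δ j k| * |y k| = |Δ j k| * (|x j| * |y k|) := by ring
    _ ≤ _ := by gcongr

lemma nigP_abs_le {d : ℕ} (x μ : EuclideanSpace ℝ (Fin d)) :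
    |∑ j, x j * μ j| ≤ (∑ j, |μ j|) * ‖x‖ := by
  rw [Finset.sum_mul]
  refine (Finset.abs_sum_le_sum_abs _ _).trans (Finset.sum_le_sum fun j _ => ?_)
  have h1 : |x j| ≤ ‖x‖ := PiLp.norm_apply_le x j
  rw [abs_mul, mul_comm]
  gcongr

lemma nigB_smul {d : ℕ} (Δ : Matrix (Fin d) (Fin d) ℝ) (r : ℝ) (x : EuclideanSpace ℝ (Fin d)) :
    nigB Δ (r • x) (r • x) = r ^ 2 * nigB Δ x x := by
  unfold nigB
  simp only [Finset.mul_sum, PiLp.smul_apply, smul_eq_mul]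
  refine Finset.sum_congr rfl fun j _ => Finset.sum_congr rfl fun k _ => ?_
  ring

lemma nigB_pos {d : ℕ} (Δ : Matrix (Fin d) (Fin d) ℝ) (h : Δ.PosDef)
    (x : EuclideanSpace ℝ (Fin d)) (hx : x ≠ 0) : 0 < nigB Δ x x := by
  have h0 : (fun j => x j) ≠ 0 := by
    intro h
    apply hx
    ext j
    exact congrFun h j
  have := h.dotProduct_mulVec_pos h0
  simp only [dotProduct, Matrix.mulVec, Finset.mul_sum, Pi.star_apply, star_trivial] at this
  unfold nigB
  simpa only [mul_assoc] using this

lemma nigB_coercive {d : ℕ} (Δ : Matrix (Fin d) (Fin d) ℝ) (h : Δ.PosDef) :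
    ∃ c : ℝ, 0 < c ∧ ∀ x : EuclideanSpace ℝ (Fin d), c ^ 2 * ‖x‖ ^ 2 ≤ nigB Δ x x := by
  have hc : Continuous fun x : EuclideanSpace ℝ (Fin d) => nigB Δ x x := by
    unfold nigB
    fun_prop
  rcases (Metric.sphere (0 : EuclideanSpace ℝ (Fin d)) 1).eq_empty_or_nonempty with he | hne
  · refine ⟨1, one_pos, fun x => ?_⟩
    have hx : x = 0 := by
      by_contra hx
      have : ‖x‖⁻¹ • x ∈ Metric.sphere (0 : EuclideanSpace ℝ (Fin d)) 1 := by
        simp [norm_smul, hx]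
      rw [he] at this
      exact this
    subst hx
    simp [nigB]
  · obtain ⟨y, hy, hmin⟩ := (isCompact_sphere (0 : EuclideanSpace ℝ (Fin d)) 1).exists_isMinOn
      hne hc.continuousOn
    have hy0 : y ≠ 0 := by
      rintro rfl
      simp at hy
    have hp := nigB_pos Δ h y hy0
    refine ⟨√(nigB Δ y y), Real.sqrt_pos.2 hp, fun x => ?_⟩
    rw [Real.sq_sqrt hp.le]
    by_cases hx : x = 0
    · subst hx
      simp [nigB]
    · have hm : ‖x‖⁻¹ • x ∈ Metric.sphere (0 : EuclideanSpace ℝ (Fin d)) 1 := by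
        simp [norm_smul, hx]
      have h1 : nigB Δ y y ≤ nigB Δ (‖x‖⁻¹ • x) (‖x‖⁻¹ • x) := hmin hm
      rw [nigB_smul] at h1
      have hn : 0 < ‖x‖ := norm_pos_iff.2 hx
      calc nigB Δ y y * ‖x‖ ^ 2 ≤ (‖x‖⁻¹ ^ 2 * nigB Δ x x) * ‖x‖ ^ 2 := by gcongr
        _ = nigB Δ x x := by field_simp

lemma Rbox_norm_le {d : ℕ} {η η' : EuclideanSpace ℝ (Fin d)} (h : η' ∈ Rbox η) :
    ‖η'‖ ≤ ‖η‖ := by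
  rw [EuclideanSpace.norm_eq, EuclideanSpace.norm_eq]
  refine Real.sqrt_le_sqrt (Finset.sum_le_sum fun j _ => ?_)
  have := Set.abs_sub_left_of_mem_uIcc (h j)
  simp only [sub_zero] at this
  simp only [Real.norm_eq_abs]
  gcongr

lemma nigSymbol_eq {d : ℕ} (at_ δ : ℝ) (β μ : EuclideanSpace ℝ (Fin d))
    (Δ : Matrix (Fin d) (Fin d) ℝ) (ξ η' : EuclideanSpace ℝ (Fin d)) :
    nigSymbol at_ δ β μ Δ (fun j => (ξ j : ℂ) - Complex.I * (η' j : ℂ)) =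
      Complex.I * ((∑ j, ξ j * μ j : ℝ) : ℂ) + ((∑ j, η' j * μ j : ℝ) : ℂ)
      - ((δ * √(at_ ^ 2 - nigB Δ β β) : ℝ) : ℂ)
      + (δ : ℂ) * (((at_ ^ 2 - nigB Δ (β + η') (β + η') + nigB Δ ξ ξ : ℝ) : ℂ)
        + ((- (nigB Δ (β + η') ξ + nigB Δ ξ (β + η')) : ℝ) : ℂ) * Complex.I) ^ (2⁻¹ : ℂ) := by
  have hw : (at_ ^ 2 : ℂ) - ∑ j, ∑ k, ((β j : ℂ) + Complex.I * ((ξ j : ℂ) - Complex.I * (η' j : ℂ)))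
        * (Δ j k : ℂ) * ((β k : ℂ) + Complex.I * ((ξ k : ℂ) - Complex.I * (η' k : ℂ))) =
      ((at_ ^ 2 - nigB Δ (β + η') (β + η') + nigB Δ ξ ξ : ℝ) : ℂ)
        + ((- (nigB Δ (β + η') ξ + nigB Δ ξ (β + η')) : ℝ) : ℂ) * Complex.I := by
    have e : ∑ j, ∑ k, ((β j : ℂ) + Complex.I * ((ξ j : ℂ) - Complex.I * (η' j : ℂ)))
        * (Δ j k : ℂ) * ((β k : ℂ) + Complex.I * ((ξ k : ℂ) - Complex.I * (η' k : ℂ))) =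
        (nigB Δ (β + η') (β + η') : ℂ) - (nigB Δ ξ ξ : ℂ) +
        ((nigB Δ (β + η') ξ : ℂ) + (nigB Δ ξ (β + η') : ℂ)) * Complex.I := by
      unfold nigB
      push_cast
      rw [← Finset.sum_sub_distrib, ← Finset.sum_add_distrib, Finset.sum_mul,
        ← Finset.sum_add_distrib]
      refine Finset.sum_congr rfl fun j _ => ?_
      rw [← Finset.sum_sub_distrib, ← Finset.sum_add_distrib, Finset.sum_mul,
        ← Finset.sum_add_distrib]
      refine Finset.sum_congr rfl fun k _ => ?_
      simp only [PiLp.add_apply]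
      push_cast
      have hI : ∀ a b c : ℂ, a + Complex.I * (b - Complex.I * c) = a + c + Complex.I * b := by
        intro a b c
        linear_combination (-c) * Complex.I_mul_I
      rw [hI, hI]
      linear_combination (ξ j : ℂ) * (Δ j k : ℂ) * (ξ k : ℂ) * Complex.I_mul_I
    rw [e]
    push_cast
    ring
  have hp : Complex.I * cpair (fun j => (ξ j : ℂ) - Complex.I * (η' j : ℂ)) (fun j => (μ j : ℂ)) =
      Complex.I * ((∑ j, ξ j * μ j : ℝ) : ℂ) + ((∑ j, η' j * μ j : ℝ) : ℂ) := by
    unfold cpair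
    push_cast
    rw [Finset.mul_sum, Finset.mul_sum, ← Finset.sum_add_distrib]
    refine Finset.sum_congr rfl fun j _ => ?_
    linear_combination (-(η' j : ℂ) * (μ j : ℂ)) * Complex.I_mul_I
  unfold nigSymbol
  rw [hw, hp, one_div]
  have : nigB Δ β β = ∑ j, ∑ k, β j * Δ j k * β k := rfl
  rw [← this]
  push_cast
  ring

lemma norm_csqrt (w : ℂ) : ‖w ^ (2⁻¹ : ℂ)‖ = √‖w‖ := by
  have := Complex.norm_cpow_inv_nat w 2
  rw [Real.sqrt_eq_rpow, one_div]
  exact_mod_cast this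

/-- Example 4.5: under the parameter restriction
`α̃² > ⟨β+η', Δ(β+η')⟩` for all `η' ∈ R_η`, the multivariate NIG symbol satisfies the
continuity condition (A2) and the Gårding condition (A3) with Sobolev index 1. -/
theorem nig_symbol_conditions
    {d : ℕ} (at_ δ : ℝ) (hat : 0 < at_) (hδ : 0 < δ)
    (β μ η : EuclideanSpace ℝ (Fin d)) (Δ : Matrix (Fin d) (Fin d) ℝ)
    (hΔsymm : Δ.IsSymm) (hΔpos : Δ.PosDef)
    (hparam : ∀ η' ∈ Rbox η,
      (∑ j, ∑ k, (β j + η' j) * Δ j k * (β k + η' k)) < at_ ^ 2) :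
    ∃ C G G' : ℝ, 0 < C ∧ 0 < G ∧ 0 ≤ G' ∧
      ∀ η' ∈ Rbox η, ∀ ξ : EuclideanSpace ℝ (Fin d),
        ‖nigSymbol at_ δ β μ Δ (fun j => (ξ j : ℂ) - Complex.I * (η' j : ℂ))‖ ≤
            C * (1 + ‖ξ‖) ∧
        (nigSymbol at_ δ β μ Δ (fun j => (ξ j : ℂ) - Complex.I * (η' j : ℂ))).re ≥
            G * (1 + ‖ξ‖) - G' := by
  obtain ⟨c, hc, hcoer⟩ := nigB_coercive Δ hΔpos
  set M : ℝ := ∑ j, ∑ k, |Δ j k| with hM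
  have hM0 : 0 ≤ M := by positivity
  set m : ℝ := ∑ j, |μ j| with hm
  have hm0 : 0 ≤ m := by positivity
  set s : ℝ := √(at_ ^ 2 - nigB Δ β β) with hs
  have hs0 : 0 ≤ s := Real.sqrt_nonneg _
  set K : ℝ := ‖β‖ + ‖η‖ with hK
  have hK0 : 0 ≤ K := by positivity
  set L : ℝ := at_ ^ 2 + M + 2 * (M * K) with hL
  have hL0 : 0 < L := by positivity
  have hsL : 0 < √L := Real.sqrt_pos.2 hL0
  refine ⟨m + m * ‖η‖ + δ * s + δ * √L, δ * c, δ * c + m * ‖η‖ + δ * s, by positivity,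
    by positivity, by positivity, fun η' hη' ξ => ?_⟩
  rw [nigSymbol_eq]
  have hP1 := nigP_abs_le ξ μ
  have hP2 := nigP_abs_le η' μ
  have hnη := Rbox_norm_le hη'
  have hP2' : |∑ j, η' j * μ j| ≤ m * ‖η‖ := hP2.trans (by gcongr)
  have hb : nigB Δ (β + η') (β + η') < at_ ^ 2 := hparam η' hη'
  have hbn : ‖β + η'‖ ≤ K := (norm_add_le _ _).trans (by rw [hK]; gcongr)
  have hb0 : 0 ≤ nigB Δ (β + η') (β + η') := le_trans (by positivity) (hcoer _)
  have hx0 := hcoer ξ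
  have hx1 := nigB_abs_le Δ ξ ξ
  have hx2 : |nigB Δ (β + η') ξ| ≤ M * (K * ‖ξ‖) := (nigB_abs_le Δ _ _).trans (by gcongr)
  have hx3 : |nigB Δ ξ (β + η')| ≤ M * (K * ‖ξ‖) :=
    (nigB_abs_le Δ _ _).trans (by rw [mul_comm ‖ξ‖]; gcongr)
  set p := ∑ j, ξ j * μ j
  set q := ∑ j, η' j * μ j
  set a := at_ ^ 2 - nigB Δ (β + η') (β + η') + nigB Δ ξ ξ with ha
  set b := - (nigB Δ (β + η') ξ + nigB Δ ξ (β + η')) with hbdef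
  set n := ‖ξ‖ with hn
  have hn0 : 0 ≤ n := norm_nonneg _
  rw [← hM] at hx1
  have hac : c ^ 2 * n ^ 2 ≤ a := by linarith
  have ha0 : 0 ≤ a := le_trans (by positivity) hac
  set w : ℂ := (a : ℂ) + (b : ℂ) * Complex.I with hw
  have hwre : w.re = a := by simp [hw]
  have hwn : ‖w‖ ≤ L * (1 + n) ^ 2 := by
    have h1 : ‖w‖ ≤ |a| + |b| := by
      refine (norm_add_le _ _).trans ?_
      simp
    have h2 : |b| ≤ M * (K * n) + M * (K * n) := by
      rw [hbdef, abs_neg]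
      exact (abs_add_le _ _).trans (add_le_add hx2 hx3)
    have h3 : |a| ≤ at_ ^ 2 + M * (n * n) := by
      rw [abs_of_nonneg ha0]
      linarith [le_abs_self (nigB Δ ξ ξ)]
    have hMK : 0 ≤ M * K := by positivity
    have e : L * (1 + n) ^ 2 - (at_ ^ 2 + M * (n * n) + (M * (K * n) + M * (K * n))) =
      at_ ^ 2 * (2 * n + n ^ 2) + M * (1 + 2 * n) + 2 * (M * K) * (1 + n + n ^ 2) := by
      rw [hL]; ring
    have : 0 ≤ at_ ^ 2 * (2 * n + n ^ 2) + M * (1 + 2 * n) + 2 * (M * K) * (1 + n + n ^ 2) := by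
      positivity
    linarith
  constructor
  · have hsq : ‖w ^ (2⁻¹ : ℂ)‖ ≤ √L * (1 + n) := by
      rw [norm_csqrt]
      refine (Real.sqrt_le_sqrt hwn).trans ?_
      rw [Real.sqrt_mul hL0.le, Real.sqrt_sq (by positivity)]
    have h1 : ‖Complex.I * (p : ℂ) + (q : ℂ) - ((δ * s : ℝ) : ℂ) + (δ : ℂ) * w ^ (2⁻¹ : ℂ)‖
        ≤ |p| + |q| + δ * s + δ * ‖w ^ (2⁻¹ : ℂ)‖ := by
      refine (norm_add_le _ _).trans (add_le_add ((norm_sub_le _ _).trans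
        (add_le_add ((norm_add_le _ _).trans ?_) ?_)) ?_)
      · simp
      · rw [Complex.norm_real, Real.norm_of_nonneg (by positivity)]
      · rw [norm_mul, Complex.norm_real, Real.norm_of_nonneg hδ.le]
    have h2 : δ * ‖w ^ (2⁻¹ : ℂ)‖ ≤ δ * (√L * (1 + n)) := by gcongr
    have h3 : 0 ≤ m + m * ‖η‖ * n + δ * s * n := by positivity
    refine h1.trans ?_
    linarith
  · have hre : c * n ≤ (w ^ (2⁻¹ : ℂ)).re := by
      rw [Complex.cpow_inv_two_re, hwre]
      refine Real.le_sqrt_of_sq_le ?_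
      have := Complex.re_le_norm w
      rw [hwre] at this
      rw [mul_pow]
      linarith
    have h2 : δ * (c * n) ≤ δ * (w ^ (2⁻¹ : ℂ)).re := by gcongr
    have e : (Complex.I * (p : ℂ) + (q : ℂ) - ((δ * s : ℝ) : ℂ) + (δ : ℂ) * w ^ (2⁻¹ : ℂ)).re
        = q - δ * s + δ * (w ^ (2⁻¹ : ℂ)).re := by
      rw [Complex.add_re, Complex.sub_re, Complex.add_re, Complex.re_ofReal_mul]
      simp
    rw [e]
    have := neg_abs_le q
    linarith
end

section
/- Let f : ℝ → [0,∞) be measurable and η ∈ ℝ; set f_η(x) := e^{ηx} f(x), and for any function φ write φ^{sym}(x) = (φ(x)+φ(−x))/2 and φ^{asym} = φ − φ^{sym}. Then: (a) f_η^{sym}(x) = cosh(ηx) f^{sym}(x) + sinh(ηx) f^{asym}(x) and f_η^{asym}(x) = sinh(ηx) f^{sym}(x) + cosh(ηx) f^{asym}(x) for all x; (b) |f^{asym}(x)| ≤ f^{sym}(x) for all x; (c) if there are constants 0 ≤ β < α < 2, C₁, C₂, ε > 0 and a function g with f^{sym}(x) ≤ C₁/|x|^{1+α} + g(x) and |g(x)|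 ≤ C₂/|x|^{1+β} for 0 < |x| < ε, then there exist constants C₁', C₂', ε' > 0 such that, with β'' := max(β, α−1) < α, one has f_η^{sym}(x) ≤ C₁'/|x|^{1+α} + g'(x) with |g'(x)| ≤ C₂'/|x|^{1+β''} for 0 < |x| < ε'; (d) if in addition |f^{asym}(x)| ≤ C₃/|x|^{1+β̃} for 0 < |x| < ε with some C₃ > 0 and β̃ ∈ [0,2), then there exist C₃', ε'' > 0 with |f_η^{asym}(x)| ≤ C₃'/|x|^{1+max(β̃, α−1)} for 0 < |x| < ε''. -/
open Real Set

/-- The symmetric part `(φ(x)+φ(−x))/2` of a function on `ℝ`. -/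
noncomputable def symPart (φ : ℝ → ℝ) (x : ℝ) : ℝ := (φ x + φ (-x)) / 2

/-- The antisymmetric part `φ − φ^{sym}` of a function on `ℝ`. -/
noncomputable def asymPart (φ : ℝ → ℝ) (x : ℝ) : ℝ := φ x - symPart φ x

/-- The exponential tilting `f_η(x) = e^{ηx} f(x)`. -/
noncomputable def tilt (η : ℝ) (f : ℝ → ℝ) (x : ℝ) : ℝ := Real.exp (η * x) * f x

/-- Monotonicity of `C / t ^ p` in the exponent for `0 < t < 1`. -/
lemma div_rpow_mono {C t p q : ℝ} (hC : 0 ≤ C) (ht : 0 < t) (ht1 : t ≤ 1) (hpq : p ≤ q) :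
    C / t ^ p ≤ C / t ^ q :=
  div_le_div_of_nonneg_left hC (rpow_pos_of_pos ht q)
    (rpow_le_rpow_of_exponent_ge ht ht1 hpq)

lemma abs_sinh_le_mul_exp (y : ℝ) : |Real.sinh y| ≤ |y| * Real.exp |y| := by
  have key : ∀ z : ℝ, 0 ≤ z → Real.sinh z ≤ z * Real.exp z := by
    intro z hz
    rw [Real.sinh_eq]
    have h1 := Real.add_one_le_exp (-2 * z)
    have h2 : Real.exp (-z) = Real.exp z * Real.exp (-2 * z) := by
      rw [← Real.exp_add]; congr 1; ring
    have h3 := Real.exp_pos z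
    rw [h2]
    nlinarith
  rw [Real.abs_sinh]
  exact key _ (abs_nonneg y)

lemma cosh_le_exp_abs' (y : ℝ) : Real.cosh y ≤ Real.exp |y| := by
  rw [Real.cosh_eq]
  have h1 := Real.exp_le_exp.2 (le_abs_self y)
  have h2 := Real.exp_le_exp.2 (neg_le_abs y)
  linarith

/-- exponential-tilting lemma from the proof of Proposition 4.7:
(a) tilting mixes the symmetric and antisymmetric parts through `cosh` and `sinh`;
(b) the antisymmetric part is dominated by the symmetric part;
(c) the small-jump growth condition (F3) on the symmetric part is preserved under
tilting with exponent `β'' = max(β, α−1)`;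
(d) the growth condition (F4) on the antisymmetric part is preserved under tilting
with exponent `max(β̃, α−1)`. -/
theorem exponential_tilting_lemma
    (f : ℝ → ℝ) (hf : Measurable f) (hf0 : ∀ x, 0 ≤ f x) (η : ℝ) :
    (∀ x, symPart (tilt η f) x =
        Real.cosh (η * x) * symPart f x + Real.sinh (η * x) * asymPart f x) ∧
    (∀ x, asymPart (tilt η f) x =
        Real.sinh (η * x) * symPart f x + Real.cosh (η * x) * asymPart f x) ∧
    (∀ x, |asymPart f x| ≤ symPart f x) ∧
    (∀ α β C₁ C₂ ε : ℝ, ∀ g : ℝ → ℝ,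
      0 ≤ β → β < α → α < 2 → 0 < C₁ → 0 < C₂ → 0 < ε →
      (∀ x : ℝ, 0 < |x| → |x| < ε →
        symPart f x ≤ C₁ / |x| ^ (1 + α) + g x ∧ |g x| ≤ C₂ / |x| ^ (1 + β)) →
      ∃ C₁' C₂' ε' : ℝ, 0 < C₁' ∧ 0 < C₂' ∧ 0 < ε' ∧ ∃ g' : ℝ → ℝ,
        ∀ x : ℝ, 0 < |x| → |x| < ε' →
          symPart (tilt η f) x ≤ C₁' / |x| ^ (1 + α) + g' x ∧
          |g' x| ≤ C₂' / |x| ^ (1 + max β (α - 1))) ∧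
    (∀ α β C₁ C₂ ε : ℝ, ∀ g : ℝ → ℝ, ∀ C₃ βt : ℝ,
      0 ≤ β → β < α → α < 2 → 0 < C₁ → 0 < C₂ → 0 < ε →
      (∀ x : ℝ, 0 < |x| → |x| < ε →
        symPart f x ≤ C₁ / |x| ^ (1 + α) + g x ∧ |g x| ≤ C₂ / |x| ^ (1 + β)) →
      0 < C₃ → 0 ≤ βt → βt < 2 →
      (∀ x : ℝ, 0 < |x| → |x| < ε → |asymPart f x| ≤ C₃ / |x| ^ (1 + βt)) →
      ∃ C₃' ε'' : ℝ, 0 < C₃' ∧ 0 < ε'' ∧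
        ∀ x : ℝ, 0 < |x| → |x| < ε'' →
          |asymPart (tilt η f) x| ≤ C₃' / |x| ^ (1 + max βt (α - 1))) := by
  have ha1 : ∀ x, symPart (tilt η f) x =
        Real.cosh (η * x) * symPart f x + Real.sinh (η * x) * asymPart f x := by
    intro x
    simp only [symPart, asymPart, tilt, Real.cosh_eq, Real.sinh_eq, mul_neg]
    ring
  have ha2 : ∀ x, asymPart (tilt η f) x =
        Real.sinh (η * x) * symPart f x + Real.cosh (η * x) * asymPart f x := by
    intro x
    simp only [symPart, asymPart, tilt, Real.cosh_eq, Real.sinh_eq, mul_neg]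
    ring
  have hb : ∀ x, |asymPart f x| ≤ symPart f x := by
    intro x
    have h1 := hf0 x
    have h2 := hf0 (-x)
    simp only [symPart, asymPart]
    rw [abs_le]
    constructor <;> linarith
  have hS0 : ∀ x, 0 ≤ symPart f x := fun x => (abs_nonneg _).trans (hb x)
  have hM : ∀ x : ℝ, |x| ≤ 1 → Real.exp |η * x| ≤ Real.exp |η| := by
    intro x hx
    apply Real.exp_le_exp.2
    rw [abs_mul]
    exact mul_le_of_le_one_right (abs_nonneg _) hx
  have hMpos : 0 < Real.exp |η| := Real.exp_pos _
  refine ⟨ha1, ha2, hb, ?_, ?_⟩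
  · intro α β C₁ C₂ ε g hβ hβα hα hC₁ hC₂ hε h
    refine ⟨Real.exp |η| * C₁, Real.exp |η| * C₂, min ε 1, by positivity, by positivity,
      by positivity, fun x => Real.exp |η| * g x, ?_⟩
    intro x hx0 hx
    obtain ⟨h1, h2⟩ := h x hx0 (hx.trans_le (min_le_left _ _))
    have hx1 : |x| ≤ 1 := hx.le.trans (min_le_right _ _)
    constructor
    · have hm := hM x hx1
      have e1 : Real.exp (η * x) ≤ Real.exp |η| :=
        (Real.exp_le_exp.2 (le_abs_self _)).trans hm
      have e2 : Real.exp (-(η * x)) ≤ Real.exp |η| :=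
        (Real.exp_le_exp.2 (neg_le_abs _)).trans hm
      have h3 : symPart (tilt η f) x ≤ Real.exp |η| * symPart f x := by
        simp only [symPart, tilt, mul_neg]
        have := mul_le_mul_of_nonneg_right e1 (hf0 x)
        have := mul_le_mul_of_nonneg_right e2 (hf0 (-x))
        linarith
      calc _ ≤ _ := h3
        _ ≤ Real.exp |η| * (C₁ / |x| ^ (1 + α) + g x) := by gcongr
        _ = _ := by ring
    · rw [abs_mul, abs_of_pos hMpos, mul_div_assoc]
      gcongr
      refine h2.trans (div_rpow_mono hC₂.le hx0 hx1 ?_)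
      gcongr
      exact le_max_left _ _
  · intro α β C₁ C₂ ε g C₃ βt hβ hβα hα hC₁ hC₂ hε h hC₃ hβt hβt2 h3
    refine ⟨Real.exp |η| * (|η| * (C₁ + C₂) + C₃), min ε 1, by positivity, by positivity, ?_⟩
    intro x hx0 hx
    have hxε := hx.trans_le (min_le_left _ _)
    obtain ⟨h1, h2⟩ := h x hx0 hxε
    have h4 := h3 x hx0 hxε
    have hx1 : |x| ≤ 1 := hx.le.trans (min_le_right _ _)
    have hm := hM x hx1
    have hs : |Real.sinh (η * x)| ≤ Real.exp |η| * |η| * |x| := by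
      refine (abs_sinh_le_mul_exp _).trans ?_
      calc |η * x| * Real.exp |η * x| ≤ |η * x| * Real.exp |η| := by gcongr
        _ = _ := by rw [abs_mul]; ring
    have hc : |Real.cosh (η * x)| ≤ Real.exp |η| := by
      rw [abs_of_pos (Real.cosh_pos _)]
      exact (cosh_le_exp_abs' _).trans hm
    have hS : symPart f x ≤ (C₁ + C₂) / |x| ^ (1 + α) := by
      have h5 : C₂ / |x| ^ (1 + β) ≤ C₂ / |x| ^ (1 + α) :=
        div_rpow_mono hC₂.le hx0 hx1 (by linarith)
      have h6 := le_abs_self (g x)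
      rw [add_div]
      linarith
    have hxS : |x| * symPart f x ≤ (C₁ + C₂) / |x| ^ (1 + max βt (α - 1)) := by
      calc |x| * symPart f x ≤ |x| * ((C₁ + C₂) / |x| ^ (1 + α)) := by gcongr
        _ = (C₁ + C₂) / |x| ^ (1 + (α - 1)) := by
          have : 1 + α = (1 + (α - 1)) + 1 := by ring
          rw [this, Real.rpow_add_one hx0.ne']
          have := (rpow_pos_of_pos hx0 (1 + (α - 1))).ne'
          field_simp
        _ ≤ _ := div_rpow_mono (by positivity) hx0 hx1 (by gcongr; exact le_max_right _ _)
    have hA : |asymPart f x| ≤ C₃ / |x| ^ (1 + max βt (α - 1)) :=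
      h4.trans (div_rpow_mono hC₃.le hx0 hx1 (by gcongr; exact le_max_left _ _))
    rw [ha2]
    calc |Real.sinh (η * x) * symPart f x + Real.cosh (η * x) * asymPart f x|
        ≤ |Real.sinh (η * x)| * symPart f x + |Real.cosh (η * x)| * |asymPart f x| := by
          refine (abs_add_le _ _).trans ?_
          rw [abs_mul, abs_mul, abs_of_nonneg (hS0 x)]
      _ ≤ (Real.exp |η| * |η| * |x|) * symPart f x + Real.exp |η| * |asymPart f x| := by
          have := hS0 x
          gcongr
      _ = Real.exp |η| * |η| * (|x| * symPart f x) + Real.exp |η| * |asymPart f x| := by ring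
      _ ≤ Real.exp |η| * |η| * ((C₁ + C₂) / |x| ^ (1 + max βt (α - 1)))
          + Real.exp |η| * (C₃ / |x| ^ (1 + max βt (α - 1))) := by gcongr
      _ = _ := by ring
end

section
/- Let C₋, C₊ ≥ 0 with C₋ + C₊ > 0, G, M > 0 and Y₋, Y₊ < 2 (with the convention Y_± := 0 if C_± = 0), and assume α := max(Y₊, Y₋) ∈ (1,2). Define the generalized tempered stable (CGMY) Lévy density f^{temp}(x) = C₋ |x|^{−1−Y₋} e^{Gx} for x < 0 and f^{temp}(x) = C₊ x^{−1−Y₊} e^{−Mx} for x > 0. Fix b ∈ ℝ and a weight η with −M < η < G, and for ξ ∈ ℝ and η' ∈ R_η define A(ξ − iη') = i(ξ − iη') b − ∫_ℝ ( e^{−i(ξ−iη')x} − 1 + i(ξ−iη') x·1_{|x|≤1} ) f^{temp}(x) dx; all integrals converge absolutely since e^{−η'x} f^{temp}(x) is integrable over {|x| > 1} and x² f^{temp}(x) is integrable near 0. Then there exist constants C, G̃ > 0, G̃' ≥ 0 and 0 ≤ β < α such that for all ξ ∈ ℝ and η' ∈ R_η: |A(ξ − iη')| ≤ C(1+|ξ|)^α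 and Re A(ξ − iη') ≥ G̃(1+|ξ|)^α − G̃'(1+|ξ|)^β. -/
open MeasureTheory Real Complex Set

/-- The generalized tempered stable (CGMY) Lévy density. -/
noncomputable def ftemp (Cm Cp G M Ym Yp : ℝ) (x : ℝ) : ℝ :=
  if x < 0 then Cm * |x| ^ (-(1 + Ym)) * Real.exp (G * x)
  else if 0 < x then Cp * x ^ (-(1 + Yp)) * Real.exp (-(M * x))
  else 0

/-- The symbol of a real-valued pure jump Lévy triplet with drift `b` and Lévy density
`f`, evaluated at the complex argument `z = ξ − iη'` (truncation `h(x) = x·1_{|x|≤1}`):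
`A(z) = i z b − ∫ (e^{−izx} − 1 + i z x 1_{|x|≤1}) f(x) dx`. -/
noncomputable def densSymbol (b : ℝ) (f : ℝ → ℝ) (ξ η' : ℝ) : ℂ :=
  Complex.I * ((ξ : ℂ) - Complex.I * (η' : ℂ)) * (b : ℂ) -
    ∫ x : ℝ, (Complex.exp (-(Complex.I * ((ξ : ℂ) - Complex.I * (η' : ℂ)) * (x : ℂ))) -
        1 + Complex.I * ((ξ : ℂ) - Complex.I * (η' : ℂ)) *
          (if |x| ≤ 1 then (x : ℂ) else 0)) * ((f x : ℝ) : ℂ)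


/-- scaling profile -/
noncomputable def mprof (α : ℝ) (u : ℝ) : ℝ := min (u ^ 2) |u| * |u| ^ (-(1 + α))

lemma mprof_nonneg (α u : ℝ) : 0 ≤ mprof α u := by
  unfold mprof; positivity

lemma mprof_measurable (α : ℝ) : Measurable (mprof α) := by
  unfold mprof; fun_prop

lemma mprof_neg (α u : ℝ) : mprof α (-u) = mprof α u := by
  unfold mprof; simp

lemma integrable_of_even_Ioi (g : ℝ → ℝ) (he : ∀ x, g (-x) = g x)
    (h : IntegrableOn g (Ioi 0)) : Integrable g := by
  rw [← integrableOn_univ, ← Set.Iic_union_Ioi (a := (0 : ℝ))]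
  refine IntegrableOn.union ?_ h
  rw [integrableOn_Iic_iff_integrableOn_Iio]
  have h' : IntegrableOn g (Ioi (-0)) := by simpa using h
  have := h'.comp_neg_Iio
  simpa [he] using this

lemma mprof_integrable (α : ℝ) (h1 : 1 < α) (h2 : α < 2) : Integrable (mprof α) := by
  apply integrable_of_even_Ioi _ (mprof_neg α)
  rw [← Set.Ioc_union_Ioi_eq_Ioi (zero_le_one' ℝ)]
  refine IntegrableOn.union ?_ ?_
  · have : IntegrableOn (fun x : ℝ => x ^ (1 - α)) (Ioc 0 1) := by
      have := intervalIntegral.intervalIntegrable_rpow' (a := 0) (b := 1) (r := 1 - α) (by linarith)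
      exact (intervalIntegrable_iff_integrableOn_Ioc_of_le zero_le_one).1 this
    refine Integrable.mono' this (mprof_measurable α).aestronglyMeasurable ?_
    filter_upwards [ae_restrict_mem measurableSet_Ioc] with x hx
    rw [Real.norm_of_nonneg (mprof_nonneg _ _)]
    unfold mprof
    have hx0 := hx.1
    rw [abs_of_pos hx0]
    calc _ ≤ x ^ 2 * x ^ (-(1 + α)) := by gcongr; exact min_le_left _ _
      _ = x ^ (1 - α) := by
        rw [← Real.rpow_natCast, ← Real.rpow_add hx0]; congr 1; push_cast; ring
  · have := integrableOn_Ioi_rpow_of_lt (a := -α) (c := 1) (by linarith) one_pos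
    refine Integrable.mono' this (mprof_measurable α).aestronglyMeasurable ?_
    filter_upwards [ae_restrict_mem measurableSet_Ioi] with x hx
    rw [Real.norm_of_nonneg (mprof_nonneg _ _)]
    unfold mprof
    have hx0 : 0 < x := lt_trans one_pos hx
    rw [abs_of_pos hx0]
    calc _ ≤ x * x ^ (-(1 + α)) := by gcongr; exact min_le_right _ _
      _ = x ^ (-α) := by
        rw [← Real.rpow_one_add' hx0.le (by linarith)]; congr 1; ring

lemma mprof_scale (α L x : ℝ) (hL : 0 < L) :
    min ((L * |x|) ^ 2) (L * |x|) * |x| ^ (-(1 + α)) = L ^ (1 + α) * mprof α (L * x) := by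
  unfold mprof
  rw [abs_mul, abs_of_pos hL, Real.mul_rpow hL.le (abs_nonneg x), mul_pow, mul_pow, sq_abs,
    Real.rpow_neg hL.le]
  have : L ^ (1 + α) ≠ 0 := (Real.rpow_pos_of_pos hL _).ne'
  field_simp

lemma exp_bound (η η' ξ x : ℝ) (hη : |η'| ≤ |η|) (hx : |x| ≤ 1) :
    ‖Complex.exp (-(Complex.I * ((ξ : ℂ) - Complex.I * (η' : ℂ)) * (x : ℂ))) -
        1 + Complex.I * ((ξ : ℂ) - Complex.I * (η' : ℂ)) * (x : ℂ)‖ ≤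
      (Real.exp |η| + 2) * (1 + |η|) ^ 2 *
        min (((1 + |ξ|) * |x|) ^ 2) ((1 + |ξ|) * |x|) := by
  set v : ℂ := -(Complex.I * ((ξ : ℂ) - Complex.I * (η' : ℂ)) * (x : ℂ)) with hv
  have hre : v.re = -(η' * x) := by simp [hv]
  have e1 : Complex.exp v - 1 + Complex.I * ((ξ : ℂ) - Complex.I * (η' : ℂ)) * (x : ℂ)
      = Complex.exp v - 1 - v := by rw [hv]; ring
  rw [e1]
  set t := (1 + |ξ|) * |x| with ht
  have ht0 : 0 ≤ t := by positivity
  set s := (1 + |η|) * t with hs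
  have hs0 : 0 ≤ s := by positivity
  have hz : ‖(ξ : ℂ) - Complex.I * (η' : ℂ)‖ ≤ |ξ| + |η'| := by
    refine (norm_sub_le _ _).trans ?_
    simp
  have hvs : ‖v‖ ≤ s := by
    rw [hv, norm_neg, norm_mul, norm_mul, Complex.norm_I, one_mul, Complex.norm_real,
      Real.norm_eq_abs, hs, ht, ← mul_assoc]
    gcongr
    refine hz.trans ?_
    nlinarith [abs_nonneg ξ, abs_nonneg η]
  have hE : 1 ≤ Real.exp |η| := Real.one_le_exp (abs_nonneg _)
  have key : ‖Complex.exp v - 1 - v‖ ≤ (Real.exp |η| + 2) * min (s ^ 2) s := by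
    rcases le_or_gt s 1 with h | h
    · have := Complex.norm_exp_sub_one_sub_id_le (hvs.trans h)
      have h3 : ‖v‖ ^ 2 ≤ s ^ 2 := by gcongr
      have h4 : min (s ^ 2) s = s ^ 2 := min_eq_left (by nlinarith)
      rw [h4]
      nlinarith [sq_nonneg s]
    · have h4 : min (s ^ 2) s = s := min_eq_right (by nlinarith)
      rw [h4]
      have h5 : ‖Complex.exp v‖ ≤ Real.exp |η| := by
        rw [Complex.norm_exp, hre]
        apply Real.exp_le_exp.2
        calc -(η' * x) ≤ |η' * x| := neg_le_abs _
          _ = |η'| * |x| := abs_mul _ _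
          _ ≤ |η| * 1 := by gcongr
          _ = |η| := mul_one _
      have h6 : ‖Complex.exp v - 1 - v‖ ≤ ‖Complex.exp v‖ + 1 + ‖v‖ := by
        refine (norm_sub_le _ _).trans ?_
        gcongr
        refine (norm_sub_le _ _).trans ?_
        simp
      nlinarith
  refine key.trans ?_
  rw [mul_assoc]
  gcongr
  have h1 : 1 ≤ 1 + |η| := by linarith [abs_nonneg η]
  rw [mul_min_of_nonneg _ _ (by positivity)]
  apply min_le_min
  · rw [hs, mul_pow]
  · rw [hs]
    gcongr
    nlinarith

lemma abs_le_of_uIcc {η η' : ℝ} (h : η' ∈ Set.uIcc (0:ℝ) η) : |η'| ≤ |η| := by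
  have := Set.abs_sub_left_of_mem_uIcc h
  simpa using this

lemma exp_le_of_uIcc {η η' : ℝ} (h : η' ∈ Set.uIcc (0:ℝ) η) (x : ℝ) :
    Real.exp (-(η' * x)) ≤ Real.exp (-(η * x)) + 1 := by
  have h1 : -(η' * x) ≤ max (-(η * x)) 0 := by
    rcases Set.mem_uIcc.1 h with h | h <;> rcases le_total 0 x with hx | hx
    · exact le_max_of_le_right (by nlinarith)
    · exact le_max_of_le_left (by nlinarith)
    · exact le_max_of_le_left (by nlinarith)
    · exact le_max_of_le_right (by nlinarith)
  have h2 := Real.exp_pos (-(η * x))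
  rcases le_max_iff.1 h1 with h | h
  · have := Real.exp_le_exp.2 h; linarith
  · have := Real.exp_le_exp.2 h; simp at this; linarith [Real.exp_le_one_iff.2 h]

/-- the integrand -/
noncomputable def dens (f : ℝ → ℝ) (ξ η' x : ℝ) : ℂ :=
  (Complex.exp (-(Complex.I * ((ξ : ℂ) - Complex.I * (η' : ℂ)) * (x : ℂ))) -
        1 + Complex.I * ((ξ : ℂ) - Complex.I * (η' : ℂ)) *
          (if |x| ≤ 1 then (x : ℂ) else 0)) * ((f x : ℝ) : ℂ)

lemma dens_measurable (f : ℝ → ℝ) (hf : Measurable f) (ξ η' : ℝ) :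
    Measurable (dens f ξ η') := by
  unfold dens
  have : Measurable (fun x : ℝ => if |x| ≤ 1 then (x : ℂ) else 0) :=
    Measurable.ite (measurableSet_le (by fun_prop) (by fun_prop)) (by fun_prop) (by fun_prop)
  fun_prop

noncomputable def tailf (f : ℝ → ℝ) (η : ℝ) : ℝ → ℝ :=
  Set.indicator {x : ℝ | 1 < |x|} (fun x => (Real.exp (-(η * x)) + 2) * f x)

lemma dens_bound (f : ℝ → ℝ) (α K η η' ξ : ℝ) (hf0 : ∀ x, 0 ≤ f x)
    (hfK : ∀ x, |x| ≤ 1 → f x ≤ K * |x| ^ (-(1 + α))) (hK : 0 ≤ K)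
    (h : η' ∈ Set.uIcc (0:ℝ) η) (x : ℝ) :
    ‖dens f ξ η' x‖ ≤ (Real.exp |η| + 2) * (1 + |η|) ^ 2 * K *
      ((1 + |ξ|) ^ (1 + α) * mprof α ((1 + |ξ|) * x)) + tailf f η x := by
  unfold dens tailf
  have hL : 0 < 1 + |ξ| := by positivity
  rw [norm_mul, Complex.norm_real, Real.norm_of_nonneg (hf0 x)]
  by_cases hx : |x| ≤ 1
  · rw [if_pos hx, Set.indicator_of_notMem (by simpa using hx), add_zero,
      ← mprof_scale _ _ _ hL]
    calc _ ≤ _ := mul_le_mul (exp_bound η η' ξ x (abs_le_of_uIcc h) hx) (hfK x hx) (hf0 x)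
            (by positivity)
      _ = _ := by ring
  · rw [if_neg hx, Set.indicator_of_mem (by simpa using hx)]
    have h1 : 0 ≤ (Real.exp |η| + 2) * (1 + |η|) ^ 2 * K *
      ((1 + |ξ|) ^ (1 + α) * mprof α ((1 + |ξ|) * x)) := by
      have := mprof_nonneg α ((1 + |ξ|) * x)
      positivity
    have h2 : ‖Complex.exp (-(Complex.I * ((ξ : ℂ) - Complex.I * (η' : ℂ)) * (x : ℂ))) -
        1 + Complex.I * ((ξ : ℂ) - Complex.I * (η' : ℂ)) * 0‖ ≤ Real.exp (-(η * x)) + 2 := by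
      rw [mul_zero, add_zero]
      refine (norm_sub_le _ _).trans ?_
      rw [Complex.norm_exp, norm_one]
      have : (-(Complex.I * ((ξ : ℂ) - Complex.I * (η' : ℂ)) * (x : ℂ))).re = -(η' * x) := by
        simp
      rw [this]
      linarith [exp_le_of_uIcc h x]
    have := mul_le_mul_of_nonneg_right h2 (hf0 x)
    linarith

lemma bound_integrable (f : ℝ → ℝ) (α K1 η ξ : ℝ) (h1 : 1 < α) (h2 : α < 2)
    (hT : Integrable (tailf f η)) :
    Integrable (fun x => K1 * ((1 + |ξ|) ^ (1 + α) * mprof α ((1 + |ξ|) * x)) + tailf f η x) := by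
  refine Integrable.add ?_ hT
  have hL : 0 < 1 + |ξ| := by positivity
  exact (((mprof_integrable α h1 h2).comp_mul_left' hL.ne').const_mul _).const_mul _

lemma bound_integral (f : ℝ → ℝ) (α K1 η ξ : ℝ) (h1 : 1 < α) (h2 : α < 2)
    (hT : Integrable (tailf f η)) :
    ∫ x, (K1 * ((1 + |ξ|) ^ (1 + α) * mprof α ((1 + |ξ|) * x)) + tailf f η x)
      = K1 * (∫ x, mprof α x) * (1 + |ξ|) ^ α + ∫ x, tailf f η x := by
  have hL : 0 < 1 + |ξ| := by positivity
  rw [integral_add ((((mprof_integrable α h1 h2).comp_mul_left' hL.ne').const_mul _).const_mul _) hT,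
    integral_const_mul, integral_const_mul, Measure.integral_comp_mul_left, abs_of_pos (inv_pos.2 hL),
    smul_eq_mul, Real.rpow_add hL, Real.rpow_one]
  field_simp

lemma dens_integrable (f : ℝ → ℝ) (α K η η' ξ : ℝ) (hf : Measurable f) (hf0 : ∀ x, 0 ≤ f x)
    (hfK : ∀ x, |x| ≤ 1 → f x ≤ K * |x| ^ (-(1 + α))) (hK : 0 ≤ K)
    (h1 : 1 < α) (h2 : α < 2) (hT : Integrable (tailf f η))
    (h : η' ∈ Set.uIcc (0:ℝ) η) : Integrable (dens f ξ η') :=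
  Integrable.mono' (bound_integrable f α _ η ξ h1 h2 hT)
    (dens_measurable f hf ξ η').aestronglyMeasurable
    (Filter.Eventually.of_forall (dens_bound f α K η η' ξ hf0 hfK hK h))

lemma symbol_upper (f : ℝ → ℝ) (α K b η : ℝ) (hf : Measurable f) (hf0 : ∀ x, 0 ≤ f x)
    (hfK : ∀ x, |x| ≤ 1 → f x ≤ K * |x| ^ (-(1 + α))) (hK : 0 ≤ K)
    (h1 : 1 < α) (h2 : α < 2) (hT : Integrable (tailf f η)) :
    ∃ C, 0 < C ∧ ∀ η' ∈ Set.uIcc (0:ℝ) η, ∀ ξ : ℝ,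
      ‖densSymbol b f ξ η'‖ ≤ C * (1 + |ξ|) ^ α := by
  set J := ∫ x, mprof α x with hJ
  have hJ0 : 0 ≤ J := integral_nonneg (mprof_nonneg α)
  set T := ∫ x, tailf f η x with hTd
  have hT0 : 0 ≤ T := integral_nonneg (fun x => Set.indicator_nonneg
    (fun x _ => mul_nonneg (by positivity) (hf0 x)) x)
  set K1 := (Real.exp |η| + 2) * (1 + |η|) ^ 2 * K with hK1
  have hK10 : 0 ≤ K1 := by positivity
  refine ⟨(1 + |η|) * |b| + K1 * J + T + 1, by positivity, ?_⟩
  intro η' h ξ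
  have hL : 1 ≤ 1 + |ξ| := by linarith [abs_nonneg ξ]
  have hLα : 1 + |ξ| ≤ (1 + |ξ|) ^ α := Real.self_le_rpow_of_one_le hL h1.le
  have hi : ‖∫ x, dens f ξ η' x‖ ≤ K1 * J * (1 + |ξ|) ^ α + T := by
    rw [hJ, hTd, ← bound_integral f α K1 η ξ h1 h2 hT]
    exact norm_integral_le_of_norm_le (bound_integrable f α _ η ξ h1 h2 hT)
      (Filter.Eventually.of_forall (dens_bound f α K η η' ξ hf0 hfK hK h))
  have hb : ‖Complex.I * ((ξ : ℂ) - Complex.I * (η' : ℂ)) * (b : ℂ)‖ ≤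
      (1 + |η|) * |b| * (1 + |ξ|) := by
    have hz : ‖(ξ : ℂ) - Complex.I * (η' : ℂ)‖ ≤ |ξ| + |η'| := by
      refine (norm_sub_le _ _).trans ?_
      simp
    rw [norm_mul, norm_mul, Complex.norm_I, one_mul, Complex.norm_real, Real.norm_eq_abs]
    have h3 : ‖(ξ : ℂ) - Complex.I * (η' : ℂ)‖ ≤ (1 + |η|) * (1 + |ξ|) := by
      have := abs_le_of_uIcc h
      nlinarith [abs_nonneg ξ, abs_nonneg η]
    calc _ ≤ (1 + |η|) * (1 + |ξ|) * |b| := by gcongr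
      _ = _ := by ring
  have e : densSymbol b f ξ η' = Complex.I * ((ξ : ℂ) - Complex.I * (η' : ℂ)) * (b : ℂ)
      - ∫ x, dens f ξ η' x := rfl
  rw [e]
  refine (norm_sub_le _ _).trans ?_
  have h4 : (1 + |η|) * |b| * (1 + |ξ|) ≤ (1 + |η|) * |b| * (1 + |ξ|) ^ α := by gcongr
  have h5 : T ≤ T * (1 + |ξ|) ^ α := by nlinarith
  nlinarith

lemma dens_re (f : ℝ → ℝ) (ξ η' x : ℝ) :
    (dens f 0 η' x - dens f ξ η' x).re =
      Real.exp (-(η' * x)) * (1 - Real.cos (ξ * x)) * f x := by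
  unfold dens
  rw [Complex.sub_re, Complex.re_mul_ofReal, Complex.re_mul_ofReal, ← sub_mul]
  congr 1
  split_ifs <;> simp [Complex.exp_re] <;> ring

lemma symbol_re_diff (f : ℝ → ℝ) (b ξ η' : ℝ) (h0 : Integrable (dens f 0 η'))
    (h1 : Integrable (dens f ξ η')) :
    (densSymbol b f ξ η').re = (densSymbol b f 0 η').re +
      ∫ x, Real.exp (-(η' * x)) * (1 - Real.cos (ξ * x)) * f x := by
  have e : ∀ ξ, densSymbol b f ξ η' = Complex.I * ((ξ : ℂ) - Complex.I * (η' : ℂ)) * (b : ℂ)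
      - ∫ x, dens f ξ η' x := fun _ => rfl
  have h2 : ∫ x, Real.exp (-(η' * x)) * (1 - Real.cos (ξ * x)) * f x
      = (∫ x, (dens f 0 η' x - dens f ξ η' x)).re := by
    simp_rw [← dens_re]
    exact integral_re (h0.sub h1)
  rw [h2, integral_sub h0 h1, e, e]
  simp

lemma symbol_lower (f : ℝ → ℝ) (α K c b η σ : ℝ) (hf : Measurable f) (hf0 : ∀ x, 0 ≤ f x)
    (hfK : ∀ x, |x| ≤ 1 → f x ≤ K * |x| ^ (-(1 + α))) (hK : 0 ≤ K)
    (h1 : 1 < α) (h2 : α < 2) (hT : Integrable (tailf f η)) (hc : 0 < c)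
    (hσ : σ = 1 ∨ σ = -1)
    (hfc : ∀ x, 0 < x → x ≤ 1 → c * x ^ (-(1 + α)) ≤ f (σ * x)) :
    ∃ C Gt Gt' β : ℝ, 0 < C ∧ 0 < Gt ∧ 0 ≤ Gt' ∧ 0 ≤ β ∧ β < α ∧
      ∀ η' ∈ Set.uIcc (0:ℝ) η, ∀ ξ : ℝ,
        ‖densSymbol b f ξ η'‖ ≤ C * (1 + |ξ|) ^ α ∧
        (densSymbol b f ξ η').re ≥ Gt * (1 + |ξ|) ^ α - Gt' * (1 + |ξ|) ^ β := by
  obtain ⟨C, hC, hup⟩ := symbol_upper f α K b η hf hf0 hfK hK h1 h2 hT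
  set κ := Real.exp (-|η|) * (2 / Real.pi ^ 2 / 4) * c with hκ
  have hκ0 : 0 < κ := by positivity
  refine ⟨C, κ / 4, C + κ / 2, 0, hC, by positivity, by positivity, le_rfl, by linarith, ?_⟩
  intro η' h ξ
  refine ⟨hup η' h ξ, ?_⟩
  have i0 := dens_integrable f α K η η' 0 hf hf0 hfK hK h1 h2 hT h
  have i1 := dens_integrable f α K η η' ξ hf hf0 hfK hK h1 h2 hT h
  rw [symbol_re_diff f b ξ η' i0 i1]
  have h3 : -C ≤ (densSymbol b f 0 η').re := by
    have h4 := hup η' h 0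
    simp only [abs_zero, add_zero, Real.one_rpow, mul_one] at h4
    have h5 := (Complex.abs_re_le_norm (densSymbol b f 0 η')).trans h4
    exact (abs_le.1 h5).1
  set g : ℝ → ℝ := fun x => Real.exp (-(η' * x)) * (1 - Real.cos (ξ * x)) * f x with hg
  have hg0 : ∀ x, 0 ≤ g x := fun x => mul_nonneg (mul_nonneg (by positivity)
    (by linarith [Real.cos_le_one (ξ * x)])) (hf0 x)
  have hgi : Integrable g := by
    have := (i0.sub i1).re
    refine this.congr (Filter.Eventually.of_forall fun x => ?_)
    exact dens_re f ξ η' x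
  set L := 1 + |ξ| with hLdef
  have hL : 1 ≤ L := by linarith [abs_nonneg ξ]
  have hL0 : 0 < L := by linarith
  -- pointwise lower bound
  have hpt : ∀ y, 1 / (2 * L) ≤ y → y ≤ 1 / L → κ * (ξ ^ 2 / L ^ 2) * L ^ (1 + α) ≤ g (σ * y) := by
    intro y hy1 hy2
    have hy0 : 0 < y := lt_of_lt_of_le (by positivity) hy1
    have hyL : y * L ≤ 1 := by rwa [le_div_iff₀ hL0] at hy2
    have hy3 : y ≤ 1 := by nlinarith
    have habs : |σ * y| = y := by
      rcases hσ with rfl | rfl <;> simp [abs_of_pos hy0]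
    have hsq : (σ * y) ^ 2 = y ^ 2 := by rw [← sq_abs, habs]
    have a1 : Real.exp (-|η|) ≤ Real.exp (-(η' * (σ * y))) := by
      apply Real.exp_le_exp.2
      apply neg_le_neg
      calc η' * (σ * y) ≤ |η' * (σ * y)| := le_abs_self _
        _ = |η'| * y := by rw [abs_mul, habs]
        _ ≤ |η| * 1 := mul_le_mul (abs_le_of_uIcc h) hy3 hy0.le (abs_nonneg _)
        _ = |η| := mul_one _
    have a2 : 2 / Real.pi ^ 2 / 4 * (ξ ^ 2 / L ^ 2) ≤ 1 - Real.cos (ξ * (σ * y)) := by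
      have b1 : |ξ * (σ * y)| ≤ Real.pi := by
        rw [abs_mul, habs]
        have : |ξ| * y ≤ 1 := by nlinarith [abs_nonneg ξ]
        linarith [Real.pi_gt_three]
      have b2 := Real.cos_le_one_sub_mul_cos_sq b1
      rw [mul_pow, hsq] at b2
      have b3 : (1 / (2 * L)) ^ 2 ≤ y ^ 2 := by gcongr
      have b4 : 2 / Real.pi ^ 2 / 4 * (ξ ^ 2 / L ^ 2) = 2 / Real.pi ^ 2 * (ξ ^ 2 * (1 / (2 * L)) ^ 2) := by
        field_simp; ring
      rw [b4]
      have b5 : 2 / Real.pi ^ 2 * (ξ ^ 2 * (1 / (2 * L)) ^ 2) ≤ 2 / Real.pi ^ 2 * (ξ ^ 2 * y ^ 2) := by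
        gcongr
      linarith
    have a3 : c * L ^ (1 + α) ≤ f (σ * y) := by
      refine le_trans ?_ (hfc y hy0 hy3)
      gcongr
      have : y ≤ L⁻¹ := by simpa using hy2
      calc L ^ (1 + α) = (L⁻¹) ^ (-(1 + α)) := by
            rw [Real.rpow_neg (by positivity), Real.inv_rpow hL0.le, inv_inv]
        _ ≤ y ^ (-(1 + α)) := Real.rpow_le_rpow_of_nonpos hy0 this (by linarith)
    calc κ * (ξ ^ 2 / L ^ 2) * L ^ (1 + α)
        = Real.exp (-|η|) * (2 / Real.pi ^ 2 / 4 * (ξ ^ 2 / L ^ 2)) * (c * L ^ (1 + α)) := by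
          rw [hκ]; ring
      _ ≤ g (σ * y) := by
          have : 0 ≤ 2 / Real.pi ^ 2 / 4 * (ξ ^ 2 / L ^ 2) := by positivity
          exact mul_le_mul (mul_le_mul a1 a2 this (Real.exp_pos _).le) a3 (by positivity)
            (mul_nonneg (Real.exp_pos _).le (this.trans a2))
  have hint : κ * (ξ ^ 2 / L ^ 2) * L ^ (1 + α) * (1 / (2 * L)) ≤ ∫ x, g x := by
    have hlen : 1 / L - 1 / (2 * L) = 1 / (2 * L) := by field_simp; norm_num
    have hle : 1 / (2 * L) ≤ 1 / L := by
      have : 0 < 1 / (2 * L) := by positivity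
      linarith
    rcases hσ with hσ | hσ
    · have := setIntegral_ge_of_const_le_real (μ := volume) (s := Icc (1 / (2 * L)) (1 / L)) (f := g)
        (c := κ * (ξ ^ 2 / L ^ 2) * L ^ (1 + α)) measurableSet_Icc (by simp)
        (fun x hx => by simpa [hσ] using hpt x hx.1 hx.2) hgi.integrableOn
      rw [Real.volume_real_Icc_of_le hle, hlen] at this
      exact this.trans (setIntegral_le_integral hgi (Filter.Eventually.of_forall hg0))
    · have := setIntegral_ge_of_const_le_real (μ := volume) (s := Icc (-(1 / L)) (-(1 / (2 * L))))
        (f := g)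
        (c := κ * (ξ ^ 2 / L ^ 2) * L ^ (1 + α)) measurableSet_Icc (by simp)
        (fun x hx => by
          have := hpt (-x) (by linarith [hx.2]) (by linarith [hx.1])
          rw [hσ] at this
          simpa using this) hgi.integrableOn
      rw [Real.volume_real_Icc_of_le (by linarith), neg_sub_neg, hlen] at this
      exact this.trans (setIntegral_le_integral hgi (Filter.Eventually.of_forall hg0))
  have e1 : κ * (ξ ^ 2 / L ^ 2) * L ^ (1 + α) * (1 / (2 * L)) = κ / 2 * (ξ ^ 2 / L ^ 2 * L ^ α) := by
    rw [Real.rpow_add hL0, Real.rpow_one]; field_simp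
  have e2 : 1 / 2 - 1 / L ^ 2 ≤ ξ ^ 2 / L ^ 2 := by
    rw [div_sub_div _ _ (by norm_num) (by positivity), div_le_div_iff₀ (by positivity) (by positivity)]
    have : L ^ 2 ≤ 2 + 2 * ξ ^ 2 := by
      rw [hLdef, ← sq_abs ξ]; nlinarith [sq_nonneg (|ξ| - 1)]
    nlinarith [sq_nonneg L, pow_pos hL0 2]
  have e3 : 1 / L ^ 2 * L ^ α ≤ 1 := by
    rw [one_div_mul_eq_div, div_le_one (by positivity), ← Real.rpow_natCast]
    exact Real.rpow_le_rpow_of_exponent_le hL (by push_cast; linarith)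
  have e4 : (1 / 2 - 1 / L ^ 2) * L ^ α ≤ ξ ^ 2 / L ^ 2 * L ^ α := by gcongr
  have e5 : κ / 2 * (L ^ α / 2 - 1) ≤ κ / 2 * (ξ ^ 2 / L ^ 2 * L ^ α) := by
    gcongr
    linarith
  rw [Real.rpow_zero]
  rw [e1] at hint
  linarith

/-! ### facts on the tempered stable density -/

lemma ftemp_measurable (Cm Cp G M Ym Yp : ℝ) : Measurable (ftemp Cm Cp G M Ym Yp) := by
  unfold ftemp
  exact Measurable.ite measurableSet_Iio (by fun_prop)
    (Measurable.ite measurableSet_Ioi (by fun_prop) (by fun_prop))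

lemma ftemp_nonneg (Cm Cp G M Ym Yp : ℝ) (hCm : 0 ≤ Cm) (hCp : 0 ≤ Cp) (x : ℝ) :
    0 ≤ ftemp Cm Cp G M Ym Yp x := by
  unfold ftemp
  split_ifs <;> positivity

lemma ftemp_le (Cm Cp G M Ym Yp : ℝ) (hCm : 0 ≤ Cm) (hCp : 0 ≤ Cp) (hG : 0 < G) (hM : 0 < M)
    (x : ℝ) (hx : |x| ≤ 1) :
    ftemp Cm Cp G M Ym Yp x ≤ (Cm + Cp) * |x| ^ (-(1 + max Yp Ym)) := by
  have hm := le_max_right Yp Ym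
  have hp := le_max_left Yp Ym
  unfold ftemp
  split_ifs with h1 h2
  · have hx0 : 0 < |x| := abs_pos.2 h1.ne
    have a : |x| ^ (-(1 + Ym)) ≤ |x| ^ (-(1 + max Yp Ym)) :=
      Real.rpow_le_rpow_of_exponent_ge hx0 hx (by linarith)
    have e : Real.exp (G * x) ≤ 1 := Real.exp_le_one_iff.2 (by nlinarith)
    calc _ ≤ Cm * |x| ^ (-(1 + max Yp Ym)) * 1 := by gcongr
      _ ≤ _ := by rw [mul_one]; gcongr; linarith
  · have hx0 : 0 < |x| := abs_pos.2 h2.ne'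
    rw [abs_of_pos h2] at *
    have a : x ^ (-(1 + Yp)) ≤ x ^ (-(1 + max Yp Ym)) :=
      Real.rpow_le_rpow_of_exponent_ge hx0 hx (by linarith)
    have e : Real.exp (-(M * x)) ≤ 1 := Real.exp_le_one_iff.2 (by nlinarith)
    calc _ ≤ Cp * x ^ (-(1 + max Yp Ym)) * 1 := by gcongr
      _ ≤ _ := by rw [mul_one]; gcongr; linarith
  · positivity

lemma tail_one (s a : ℝ) (ha : 0 < a) :
    IntegrableOn (fun x : ℝ => x ^ s * Real.exp (-(a * x))) (Ioi 1) := by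
  have h := (integrableOn_rpow_mul_exp_neg_mul_rpow (p := 1) (s := |s|) (b := a)
    (by linarith [abs_nonneg s]) one_pos ha).mono_set (Set.Ioi_subset_Ioi zero_le_one)
  refine Integrable.mono' h (by fun_prop) ?_
  filter_upwards [ae_restrict_mem measurableSet_Ioi] with x hx
  have hx1 : 1 < x := hx
  have hx0 : 0 < x := by linarith
  rw [Real.norm_of_nonneg (by positivity), Real.rpow_one, neg_mul]
  gcongr
  · exact hx1.le
  · exact le_abs_self s

lemma ftemp_tail (Cm Cp G M Ym Yp η : ℝ) (hG : 0 < G) (hM : 0 < M)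
    (hη1 : -M < η) (hη2 : η < G) : Integrable (tailf (ftemp Cm Cp G M Ym Yp) η) := by
  unfold tailf
  have hms : MeasurableSet {x : ℝ | 1 < |x|} := measurableSet_lt (by fun_prop) (by fun_prop)
  rw [integrable_indicator_iff hms]
  have hset : {x : ℝ | 1 < |x|} = Iio (-1) ∪ Ioi 1 := by
    ext x
    simp only [mem_ofPred_eq, lt_abs, mem_union, mem_Iio, mem_Ioi]
    constructor
    · rintro (h | h)
      · right; exact h
      · left; linarith
    · rintro (h | h)
      · right; linarith
      · left; exact h
  rw [hset]
  refine IntegrableOn.union ?_ ?_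
  · have i1 := ((tail_one (-(1 + Ym)) (G - η) (by linarith)).const_mul Cm).add
      (((tail_one (-(1 + Ym)) G hG).const_mul Cm).const_mul 2)
    rw [← neg_neg (1 : ℝ)] at i1
    refine IntegrableOn.congr_fun (IntegrableOn.comp_neg_Iio i1) ?_ measurableSet_Iio
    intro x hx
    have hx0 : x < 0 := by have : x < -1 := hx; linarith
    simp only [Pi.add_apply]
    unfold ftemp
    rw [if_pos hx0, abs_of_neg hx0]
    have e : Real.exp (-((G - η) * -x)) = Real.exp (-(η * x)) * Real.exp (G * x) := by
      rw [← Real.exp_add]; congr 1; ring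
    have e' : Real.exp (-(G * -x)) = Real.exp (G * x) := by congr 1; ring
    rw [e, e']; ring
  · have i1 := ((tail_one (-(1 + Yp)) (M + η) (by linarith)).const_mul Cp).add
      (((tail_one (-(1 + Yp)) M hM).const_mul Cp).const_mul 2)
    refine IntegrableOn.congr_fun i1 ?_ measurableSet_Ioi
    intro x hx
    have hx0 : 0 < x := by have : 1 < x := hx; linarith
    simp only [Pi.add_apply]
    unfold ftemp
    rw [if_neg hx0.not_gt, if_pos hx0]
    have e : Real.exp (-((M + η) * x)) = Real.exp (-(η * x)) * Real.exp (-(M * x)) := by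
      rw [← Real.exp_add]; congr 1; ring
    rw [e]; ring

/-- Example 4.8 (i): for `α = max(Y₊,Y₋) ∈ (1,2)` the generalized
tempered stable (CGMY) symbol satisfies the continuity condition (A2) and the Gårding
condition (A3) with Sobolev index `α` for every weight `η ∈ (−M, G)`. -/
theorem tempered_stable_symbol_conditions
    (Cm Cp G M Ym Yp b η : ℝ)
    (hCm : 0 ≤ Cm) (hCp : 0 ≤ Cp) (hCsum : 0 < Cm + Cp)
    (hG : 0 < G) (hM : 0 < M) (hYm : Ym < 2) (hYp : Yp < 2)
    (hconvm : Cm = 0 → Ym = 0) (hconvp : Cp = 0 → Yp = 0)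
    (hα1 : 1 < max Yp Ym) (hα2 : max Yp Ym < 2)
    (hη1 : -M < η) (hη2 : η < G) :
    ∃ C Gt Gt' β : ℝ, 0 < C ∧ 0 < Gt ∧ 0 ≤ Gt' ∧ 0 ≤ β ∧ β < max Yp Ym ∧
      ∀ η' ∈ Set.uIcc (0:ℝ) η, ∀ ξ : ℝ,
        ‖densSymbol b (ftemp Cm Cp G M Ym Yp) ξ η'‖ ≤
            C * (1 + |ξ|) ^ (max Yp Ym) ∧
        (densSymbol b (ftemp Cm Cp G M Ym Yp) ξ η').re ≥
            Gt * (1 + |ξ|) ^ (max Yp Ym) - Gt' * (1 + |ξ|) ^ β := by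
  have hf := ftemp_measurable Cm Cp G M Ym Yp
  have hf0 := ftemp_nonneg Cm Cp G M Ym Yp hCm hCp
  have hfK := ftemp_le Cm Cp G M Ym Yp hCm hCp hG hM
  have hT := ftemp_tail Cm Cp G M Ym Yp η hG hM hη1 hη2
  rcases le_total Ym Yp with hY | hY
  · have hmax : max Yp Ym = Yp := max_eq_left hY
    have hCp0 : 0 < Cp := by
      refine lt_of_le_of_ne hCp fun h => ?_
      have := hconvp h.symm
      linarith
    refine symbol_lower _ _ (Cm + Cp) (Cp * Real.exp (-M)) b η 1 hf hf0 hfK hCsum.le hα1 hα2 hT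
      (by positivity) (Or.inl rfl) ?_
    intro x hx hx1
    unfold ftemp
    rw [one_mul, if_neg hx.not_gt, if_pos hx, hmax]
    have : Real.exp (-M) ≤ Real.exp (-(M * x)) := Real.exp_le_exp.2 (by nlinarith)
    calc _ = Cp * x ^ (-(1 + Yp)) * Real.exp (-M) := by ring
      _ ≤ _ := by gcongr
  · have hmax : max Yp Ym = Ym := max_eq_right hY
    have hCm0 : 0 < Cm := by
      refine lt_of_le_of_ne hCm fun h => ?_
      have := hconvm h.symm
      linarith
    refine symbol_lower _ _ (Cm + Cp) (Cm * Real.exp (-G)) b η (-1) hf hf0 hfK hCsum.le hα1 hα2 hT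
      (by positivity) (Or.inr rfl) ?_
    intro x hx hx1
    unfold ftemp
    rw [neg_one_mul, if_pos (by linarith), abs_neg, abs_of_pos hx, hmax]
    have : Real.exp (-G) ≤ Real.exp (G * -x) := Real.exp_le_exp.2 (by nlinarith)
    calc _ = Cm * x ^ (-(1 + Ym)) * Real.exp (-G) := by ring
      _ ≤ _ := by gcongr
end

section
/- Let η ∈ ℝ^d, α ∈ (0,2], T > 0, m ∈ ℝ, 0 ≤ β < α, G > 0, G' ≥ 0, and let (u,ξ) ↦ A_u(ξ − iη) ∈ ℂ be a given family such that u ↦ A_u(ξ − iη) is integrable on [0,T] for each ξ and Re A_u(ξ − iη) ≥ G(1+|ξ|)^α − G'(1+|ξ|)^β for all u ∈ [0,T] and ξ ∈ ℝ^d. Then there exists a constant c > 0 such that for every measurable v : ℝ^d → ℂ: ∫_0^T ∫_{ℝ^d} (1+|ξ|)^{mα} |v(ξ)|² · |exp( −∫_{T−t}^{T} A_u(ξ − iη) du )|² dξ dt ≤ c ∫_{ℝ^d} (1+|ξ|)^{(m−1)α} |v(ξ)|² dξ. -/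
open MeasureTheory Real Complex Set
open scoped ENNReal

lemma aux_garding (α β G G' : ℝ) (hβ0 : 0 ≤ β) (hβα : β < α) (hG : 0 < G) (hG' : 0 ≤ G') :
    ∃ K : ℝ, 0 ≤ K ∧ ∀ x : ℝ, 1 ≤ x → G / 2 * x ^ α - K ≤ G * x ^ α - G' * x ^ β := by
  set R : ℝ := (2 * G' / G) ^ (1 / (α - β)) with hR
  have hb : 0 ≤ 2 * G' / G := by positivity
  have hR0 : 0 ≤ R := Real.rpow_nonneg hb _
  have hd : 0 < α - β := by linarith
  refine ⟨G' * R ^ β, by positivity, fun x hx => ?_⟩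
  have hx0 : 0 < x := by linarith
  have hxa : 0 < x ^ α := Real.rpow_pos_of_pos hx0 _
  have hxb : 0 < x ^ β := Real.rpow_pos_of_pos hx0 _
  rcases le_total x R with h | h
  · have h1 : x ^ β ≤ R ^ β := Real.rpow_le_rpow hx0.le h hβ0
    have h2 := mul_le_mul_of_nonneg_left h1 hG'
    nlinarith
  · have h1 : R ^ (α - β) ≤ x ^ (α - β) := Real.rpow_le_rpow hR0 h hd.le
    have h2 : R ^ (α - β) = 2 * G' / G := by
      rw [hR, ← Real.rpow_mul hb, one_div_mul_cancel hd.ne', Real.rpow_one]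
    have h3 : x ^ α = x ^ (α - β) * x ^ β := by
      rw [← Real.rpow_add hx0]; congr 1; ring
    rw [h2, div_le_iff₀ hG] at h1
    have h4 := mul_le_mul_of_nonneg_right h1 hxb.le
    have h5 : 0 ≤ G' * R ^ β := by positivity
    rw [h3]
    nlinarith

lemma aux_exp (T a : ℝ) (hT : 0 < T) (ha : 0 < a) :
    ∫⁻ t in Set.Icc (0:ℝ) T, ENNReal.ofReal (Real.exp (-a * t)) ≤ ENNReal.ofReal (1 / a) := by
  have hc : Continuous fun t : ℝ => Real.exp (-a * t) := by fun_prop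
  rw [← ofReal_integral_eq_lintegral_ofReal
    (hc.continuousOn.integrableOn_Icc) (Filter.Eventually.of_forall fun t => (Real.exp_pos _).le)]
  apply ENNReal.ofReal_le_ofReal
  rw [integral_Icc_eq_integral_Ioc, ← intervalIntegral.integral_of_le hT.le]
  have : (∫ t in (0:ℝ)..T, Real.exp (-a * t)) = (1 - Real.exp (-a * T)) / a := by
    rw [intervalIntegral.integral_comp_mul_left (fun y => Real.exp y) (neg_ne_zero.2 ha.ne'),
      integral_exp]
    simp only [mul_zero, Real.exp_zero, smul_eq_mul]
    field_simp
    ring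
  rw [this]
  gcongr
  linarith [Real.exp_pos (-a * T)]

/-- homogeneous smoothing estimate from the proof of Lemma 7.1(i):
the Gårding condition with index `α` on the shifted symbol `A u ξ = A_u(ξ − iη)`
yields a gain of `α/2` derivatives for the propagated initial datum. -/
theorem propagator_smoothing_estimate
    {d : ℕ} (T : ℝ) (hT : 0 < T) (η : EuclideanSpace ℝ (Fin d))
    (α β m G G' : ℝ) (hα : α ∈ Set.Ioc (0:ℝ) 2) (hβ0 : 0 ≤ β) (hβα : β < α)
    (hG : 0 < G) (hG' : 0 ≤ G')
    (A : ℝ → EuclideanSpace ℝ (Fin d) → ℂ)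
    (hInt : ∀ ξ, IntegrableOn (fun u => A u ξ) (Set.Icc 0 T))
    (hgard : ∀ u ∈ Set.Icc (0:ℝ) T, ∀ ξ,
      (A u ξ).re ≥ G * (1 + ‖ξ‖) ^ α - G' * (1 + ‖ξ‖) ^ β) :
    ∃ c : ℝ, 0 < c ∧
      ∀ v : EuclideanSpace ℝ (Fin d) → ℂ, Measurable v →
        (∫⁻ t in Set.Icc (0:ℝ) T, ∫⁻ ξ : EuclideanSpace ℝ (Fin d),
            ENNReal.ofReal ((1 + ‖ξ‖) ^ (m * α) * ‖v ξ‖ ^ 2 *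
              ‖Complex.exp (-(∫ u in (T - t)..T, A u ξ))‖ ^ 2)) ≤
          ENNReal.ofReal c * ∫⁻ ξ : EuclideanSpace ℝ (Fin d),
            ENNReal.ofReal ((1 + ‖ξ‖) ^ ((m - 1) * α) * ‖v ξ‖ ^ 2) := by
  obtain ⟨K, hK, hKx⟩ := aux_garding α β G G' hβ0 hβα hG hG'
  refine ⟨Real.exp (2 * T * K) / G, by positivity, fun v hv => ?_⟩
  have key : ∀ t ∈ Set.Icc (0:ℝ) T, ∀ ξ : EuclideanSpace ℝ (Fin d),
      ‖Complex.exp (-(∫ u in (T - t)..T, A u ξ))‖ ^ 2 ≤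
        Real.exp (2 * T * K) * Real.exp (-(G * (1 + ‖ξ‖) ^ α) * t) := by
    intro t ht ξ
    have hle : T - t ≤ T := by linarith [ht.1]
    have hii : IntervalIntegrable (fun u => A u ξ) volume (T - t) T := by
      rw [intervalIntegrable_iff_integrableOn_Icc_of_le hle]
      exact (hInt ξ).mono_set (Set.Icc_subset_Icc (by linarith [ht.2]) le_rfl)
    have hre : (∫ u in (T - t)..T, A u ξ).re = ∫ u in (T - t)..T, (A u ξ).re := by
      have := Complex.reCLM.intervalIntegral_comp_comm hii
      simpa using this.symm
    have hlow : t * (G / 2 * (1 + ‖ξ‖) ^ α - K) ≤ ∫ u in (T - t)..T, (A u ξ).re := by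
      have h0 : (∫ u in (T - t)..T, (G / 2 * (1 + ‖ξ‖) ^ α - K)) =
          t * (G / 2 * (1 + ‖ξ‖) ^ α - K) := by
        rw [intervalIntegral.integral_const, smul_eq_mul]; ring
      rw [← h0]
      apply intervalIntegral.integral_mono_on hle (by simp)
      · rw [intervalIntegrable_iff] at hii ⊢
        exact hii.re
      · intro u hu
        exact (hKx (1 + ‖ξ‖) (by linarith [norm_nonneg ξ])).trans
          (hgard u ⟨by linarith [hu.1, ht.2], hu.2⟩ ξ)
    rw [Complex.norm_exp, Complex.neg_re, hre, ← Real.exp_nat_mul, ← Real.exp_add]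
    apply Real.exp_le_exp.2
    have := mul_le_mul_of_nonneg_right ht.2 hK
    push_cast
    nlinarith
  have hm1 : Measurable fun ξ : EuclideanSpace ℝ (Fin d) => (1 + ‖ξ‖) ^ (m * α) * ‖v ξ‖ ^ 2 := by
    fun_prop
  calc _ ≤ ∫⁻ t in Set.Icc (0:ℝ) T, ∫⁻ ξ : EuclideanSpace ℝ (Fin d),
            ENNReal.ofReal ((1 + ‖ξ‖) ^ (m * α) * ‖v ξ‖ ^ 2 *
              (Real.exp (2 * T * K) * Real.exp (-(G * (1 + ‖ξ‖) ^ α) * t))) := by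
        apply setLIntegral_mono' measurableSet_Icc
        intro t ht
        apply lintegral_mono
        intro ξ
        apply ENNReal.ofReal_le_ofReal
        exact mul_le_mul_of_nonneg_left (key t ht ξ) (by positivity)
    _ = ∫⁻ ξ : EuclideanSpace ℝ (Fin d), ∫⁻ t in Set.Icc (0:ℝ) T,
            ENNReal.ofReal ((1 + ‖ξ‖) ^ (m * α) * ‖v ξ‖ ^ 2 *
              (Real.exp (2 * T * K) * Real.exp (-(G * (1 + ‖ξ‖) ^ α) * t))) := by
        apply lintegral_lintegral_swap
        apply Measurable.aemeasurable
        simp only [Function.uncurry_def]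
        fun_prop
    _ ≤ ∫⁻ ξ : EuclideanSpace ℝ (Fin d), ENNReal.ofReal (Real.exp (2 * T * K) / G) *
            ENNReal.ofReal ((1 + ‖ξ‖) ^ ((m - 1) * α) * ‖v ξ‖ ^ 2) := by
        apply lintegral_mono
        intro ξ
        have hx : 0 < 1 + ‖ξ‖ := by positivity
        have hxa : 0 < (1 + ‖ξ‖) ^ α := Real.rpow_pos_of_pos hx _
        have hC : 0 ≤ (1 + ‖ξ‖) ^ (m * α) * ‖v ξ‖ ^ 2 * Real.exp (2 * T * K) := by positivity
        simp only [← mul_assoc]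
        simp only [ENNReal.ofReal_mul hC]
        rw [lintegral_const_mul _ (by fun_prop)]
        refine (mul_le_mul_right (aux_exp T (G * (1 + ‖ξ‖) ^ α) hT (by positivity)) _).trans ?_
        rw [← ENNReal.ofReal_mul hC, ← ENNReal.ofReal_mul (by positivity)]
        apply ENNReal.ofReal_le_ofReal
        have : (1 + ‖ξ‖) ^ (m * α) = (1 + ‖ξ‖) ^ ((m - 1) * α) * (1 + ‖ξ‖) ^ α := by
          rw [← Real.rpow_add hx]; congr 1; ring
        rw [this]
        apply le_of_eq
        field_simp
    _ = _ := by
        rw [lintegral_const_mul]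
        fun_prop
end

section
/- Let η ∈ ℝ^d, α ∈ (0,2], T > 0, m ∈ ℝ, 0 ≤ β < α, G > 0, G' ≥ 0, and let (u,ξ) ↦ A_u(ξ − iη) ∈ ℂ be a given family such that u ↦ A_u(ξ − iη) is integrable on [0,T] for each ξ and Re A_u(ξ − iη) ≥ G(1+|ξ|)^α − G'(1+|ξ|)^β for all u ∈ [0,T] and ξ ∈ ℝ^d. Then there exists a constant c > 0 such that for every measurable w : [0,T] × ℝ^d → ℂ: ∫_0^T ∫_{ℝ^d} (1+|ξ|)^{mα} | ∫_0^t w(s,ξ) · exp( −∫_{T−t}^{T−s} A_u(ξ − iη) du ) ds |² dξ dt ≤ c ∫_0^T ∫_{ℝ^d} (1+|ξ|)^{(m−1)α} |w(s,ξ)|² dξ ds. -/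
open MeasureTheory Real Complex Set
open scoped ENNReal

/-- Weighted Cauchy-Schwarz. -/
lemma duh_cs {X : Type*} [MeasurableSpace X] (μ : Measure X) (f k : X → ℝ≥0∞)
    (hf : Measurable f) (hk : Measurable k) :
    (∫⁻ x, f x * k x ∂μ) ^ 2 ≤ (∫⁻ x, k x ∂μ) * ∫⁻ x, f x ^ 2 * k x ∂μ := by
  have h := ENNReal.lintegral_mul_le_Lp_mul_Lq μ (Real.HolderConjugate.two_two)
    (f := fun x => f x * k x ^ (1/2 : ℝ)) (g := fun x => k x ^ (1/2 : ℝ))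
    (by fun_prop) (by fun_prop)
  have hk2 : ∀ x, k x ^ (1/2 : ℝ) * k x ^ (1/2 : ℝ) = k x := by
    intro x
    rw [← ENNReal.rpow_add_of_nonneg _ _ (by norm_num) (by norm_num)]
    norm_num
  have hk3 : ∀ y : ℝ≥0∞, (y ^ (1/2 : ℝ)) ^ 2 = y := by
    intro y
    rw [sq, ← ENNReal.rpow_add_of_nonneg _ _ (by norm_num) (by norm_num)]
    norm_num
  simp only [Pi.mul_apply, mul_assoc, hk2, ENNReal.rpow_two, mul_pow, hk3] at h
  calc (∫⁻ x, f x * k x ∂μ) ^ 2 ≤ _ := pow_le_pow_left' h 2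
    _ = _ := by rw [mul_pow, hk3, hk3, mul_comm]

/-- The causal exponential kernel. -/
noncomputable def duhK (l x : ℝ) : ℝ≥0∞ := if 0 ≤ x then ENNReal.ofReal (Real.exp (-(l * x))) else 0

lemma duhK_meas : Measurable (Function.uncurry duhK) := by
  unfold duhK Function.uncurry
  apply Measurable.ite
  · exact measurableSet_le measurable_const measurable_snd
  · fun_prop
  · fun_prop

lemma duhK_int (l : ℝ) (hl : 0 < l) : ∫⁻ x, duhK l x = ENNReal.ofReal (1 / l) := by
  have h1 : ∫⁻ x, duhK l x = ∫⁻ x in Ici 0, ENNReal.ofReal (Real.exp (-l * x)) := by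
    rw [← lintegral_indicator measurableSet_Ici]
    refine lintegral_congr fun x => ?_
    simp [duhK, Set.indicator]
  rw [h1, setLIntegral_congr Ioi_ae_eq_Ici.symm, ← ofReal_integral_eq_lintegral_ofReal]
  · rw [integral_exp_mul_Ioi (by linarith)]
    simp
  · exact integrableOn_exp_mul_Ioi (by linarith) 0
  · exact Filter.Eventually.of_forall fun x => (Real.exp_pos _).le

lemma duh_young (α β G G' : ℝ) (hβ0 : 0 ≤ β) (hβα : β < α) (hG : 0 < G) (hG' : 0 ≤ G') :
    ∃ K : ℝ, 0 ≤ K ∧ ∀ g : ℝ, 1 ≤ g → G' * g ^ β ≤ G / 2 * g ^ α + K := by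
  set R := (2 * G' / G) ^ (1 / (α - β)) with hR
  have hR0 : 0 ≤ R := by positivity
  refine ⟨G' * R ^ β, by positivity, fun g hg => ?_⟩
  have hg0 : 0 < g := by linarith
  rcases le_total g R with h | h
  · have : g ^ β ≤ R ^ β := Real.rpow_le_rpow hg0.le h hβ0
    have h2 : G' * g ^ β ≤ G' * R ^ β := by gcongr
    have h3 : 0 ≤ G / 2 * g ^ α := by positivity
    linarith
  · have h1 : R ^ (α - β) ≤ g ^ (α - β) := Real.rpow_le_rpow hR0 h (by linarith)
    rw [hR, ← Real.rpow_mul (by positivity), one_div_mul_cancel (by linarith), Real.rpow_one,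
      div_le_iff₀ hG] at h1
    have h2 : g ^ α = g ^ (α - β) * g ^ β := by rw [← Real.rpow_add hg0]; simp
    have h3 : 0 ≤ G' * R ^ β := by positivity
    have h4 : 0 < g ^ β := by positivity
    rw [h2]
    nlinarith

/-- Pointwise (in `t`, `ξ`) bound for the Duhamel integral. -/
lemma duh_pt (T l K : ℝ) (hl : 0 < l) (hK : 0 ≤ K) (a w : ℝ → ℂ)
    (ha : IntegrableOn a (Icc 0 T)) (hre : ∀ u ∈ Icc (0:ℝ) T, l - K ≤ (a u).re)
    (hw : Measurable w) (t : ℝ) (ht : t ∈ Icc 0 T) :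
    ‖∫ s in (0:ℝ)..t, w s * Complex.exp (-(∫ u in (T - t)..(T - s), a u))‖ₑ ^ 2 ≤
      ENNReal.ofReal (Real.exp (2 * K * T)) * (ENNReal.ofReal (1 / l) *
        ∫⁻ s in Icc 0 T, ‖w s‖ₑ ^ 2 * duhK l (t - s)) := by
  obtain ⟨ht0, htT⟩ := ht
  have hkm : Measurable fun s => duhK l (t - s) :=
    duhK_meas.comp (f := fun s : ℝ => (l, t - s)) (by fun_prop)
  have key : ∀ s ∈ Ioc 0 t, ‖w s * Complex.exp (-(∫ u in (T - t)..(T - s), a u))‖ₑ ≤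
      ENNReal.ofReal (Real.exp (K * T)) * (‖w s‖ₑ * duhK l (t - s)) := by
    intro s hs
    have hs1 := hs.1
    have hs2 := hs.2
    have hsub : Icc (T - t) (T - s) ⊆ Icc 0 T := Icc_subset_Icc (by linarith) (by linarith)
    have hii : IntervalIntegrable a volume (T - t) (T - s) := by
      rw [intervalIntegrable_iff_integrableOn_Icc_of_le (by linarith)]
      exact ha.mono_set hsub
    have hre' : (l - K) * (t - s) ≤ (∫ u in (T - t)..(T - s), a u).re := by
      have e : (∫ u in (T - t)..(T - s), a u).re = ∫ u in (T - t)..(T - s), (a u).re := by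
        have := (Complex.reCLM.intervalIntegral_comp_comm hii)
        simpa using this.symm
      rw [e]
      have h := intervalIntegral.integral_mono_on (a := T - t) (b := T - s) (by linarith)
        (intervalIntegrable_const (c := l - K) (μ := volume)) (g := fun u => (a u).re)
        ⟨hii.1.re, hii.2.re⟩ (fun u hu => hre u (hsub hu))
      rw [intervalIntegral.integral_const] at h
      simp only [smul_eq_mul] at h
      linarith
    rw [enorm_mul, ← ofReal_norm (Complex.exp _), Complex.norm_exp, duhK,
      if_pos (by linarith), mul_left_comm, ← ENNReal.ofReal_mul (Real.exp_pos _).le, ← Real.exp_add]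
    gcongr
    rw [Complex.neg_re]
    have : K * (t - s) ≤ K * T := by gcongr; linarith
    nlinarith
  have hb : ‖∫ s in (0:ℝ)..t, w s * Complex.exp (-(∫ u in (T - t)..(T - s), a u))‖ₑ ≤
      ENNReal.ofReal (Real.exp (K * T)) * ∫⁻ s in Icc 0 T, ‖w s‖ₑ * duhK l (t - s) := by
    rw [intervalIntegral.integral_of_le ht0]
    refine (enorm_integral_le_lintegral_enorm _).trans ?_
    refine (setLIntegral_mono' measurableSet_Ioc key).trans ?_
    rw [lintegral_const_mul _ (by fun_prop)]
    gcongr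
    exact fun x hx => ⟨hx.1.le, hx.2.trans htT⟩
  calc _ ≤ _ := pow_le_pow_left' hb 2
    _ ≤ _ := by
      rw [mul_pow]
      refine mul_le_mul' (le_of_eq ?_) ?_
      · rw [← ENNReal.ofReal_pow (Real.exp_pos _).le, ← Real.exp_nat_mul]
        congr 2; push_cast; ring
      · refine (duh_cs _ (fun s => ‖w s‖ₑ) (fun s => duhK l (t - s)) (by fun_prop) hkm).trans ?_
        gcongr
        rw [← duhK_int l hl, ← lintegral_sub_left_eq_self (duhK l) t]
        exact setLIntegral_le_lintegral _ _

/-- Duhamel-term smoothing estimate from the proof of Lemma 7.1(i):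
the Gårding condition with index `α` on the shifted symbol `A u ξ = A_u(ξ − iη)`
yields a gain of `α/2` derivatives for the Duhamel part of the solution. -/
theorem duhamel_smoothing_estimate
    {d : ℕ} (T : ℝ) (hT : 0 < T) (η : EuclideanSpace ℝ (Fin d))
    (α β m G G' : ℝ) (hα : α ∈ Set.Ioc (0:ℝ) 2) (hβ0 : 0 ≤ β) (hβα : β < α)
    (hG : 0 < G) (hG' : 0 ≤ G')
    (A : ℝ → EuclideanSpace ℝ (Fin d) → ℂ)
    (hInt : ∀ ξ, IntegrableOn (fun u => A u ξ) (Set.Icc 0 T))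
    (hgard : ∀ u ∈ Set.Icc (0:ℝ) T, ∀ ξ,
      (A u ξ).re ≥ G * (1 + ‖ξ‖) ^ α - G' * (1 + ‖ξ‖) ^ β) :
    ∃ c : ℝ, 0 < c ∧
      ∀ w : ℝ → EuclideanSpace ℝ (Fin d) → ℂ,
        Measurable (Function.uncurry w) →
        (∫⁻ t in Set.Icc (0:ℝ) T, ∫⁻ ξ : EuclideanSpace ℝ (Fin d),
            ENNReal.ofReal ((1 + ‖ξ‖) ^ (m * α) *
              ‖∫ s in (0:ℝ)..t, w s ξ *
                  Complex.exp (-(∫ u in (T - t)..(T - s), A u ξ))‖ ^ 2)) ≤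
          ENNReal.ofReal c * ∫⁻ s in Set.Icc (0:ℝ) T,
            ∫⁻ ξ : EuclideanSpace ℝ (Fin d),
              ENNReal.ofReal ((1 + ‖ξ‖) ^ ((m - 1) * α) * ‖w s ξ‖ ^ 2) := by
  obtain ⟨K, hK, hY⟩ := duh_young α β G G' hβ0 hβα hG hG'
  refine ⟨Real.exp (2 * K * T) * (4 / G ^ 2), by positivity, fun w hw => ?_⟩
  let L : EuclideanSpace ℝ (Fin d) → ℝ := fun ξ => G / 2 * (1 + ‖ξ‖) ^ α
  have hg1 : ∀ ξ : EuclideanSpace ℝ (Fin d), 1 ≤ 1 + ‖ξ‖ := fun ξ => by simp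
  have hgp : ∀ ξ : EuclideanSpace ℝ (Fin d), 0 < 1 + ‖ξ‖ := fun ξ => by positivity
  have hL : ∀ ξ, 0 < L ξ := fun ξ => mul_pos (by positivity) (Real.rpow_pos_of_pos (hgp ξ) _)
  have hLm : Measurable L := by fun_prop
  let E := ENNReal.ofReal (Real.exp (2 * K * T))
  let P : EuclideanSpace ℝ (Fin d) → ℝ≥0∞ := fun ξ =>
    ENNReal.ofReal ((1 + ‖ξ‖) ^ (m * α)) * (E * ENNReal.ofReal (1 / L ξ))
  have hPm : Measurable P := by fun_prop
  have hwm : Measurable fun p : ℝ × EuclideanSpace ℝ (Fin d) => w p.1 p.2 := hw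
  let F : ℝ → EuclideanSpace ℝ (Fin d) → ℝ → ℝ≥0∞ := fun t ξ s =>
    P ξ * (‖w s ξ‖ₑ ^ 2 * duhK (L ξ) (t - s))
  have hFm : Measurable fun p : (ℝ × EuclideanSpace ℝ (Fin d)) × ℝ => F p.1.1 p.1.2 p.2 := by
    have h1 : Measurable fun p : (ℝ × EuclideanSpace ℝ (Fin d)) × ℝ => w p.2 p.1.2 :=
      hwm.comp (f := fun p : (ℝ × EuclideanSpace ℝ (Fin d)) × ℝ => (p.2, p.1.2)) (by fun_prop)
    have h2 : Measurable fun p : (ℝ × EuclideanSpace ℝ (Fin d)) × ℝ =>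
        duhK (L p.1.2) (p.1.1 - p.2) :=
      duhK_meas.comp (f := fun p : (ℝ × EuclideanSpace ℝ (Fin d)) × ℝ =>
        (L p.1.2, p.1.1 - p.2)) (by fun_prop)
    exact (hPm.comp (by fun_prop)).mul ((h1.enorm.pow_const 2).mul h2)
  have hFsec : ∀ ξ, Measurable fun p : ℝ × ℝ => F p.1 ξ p.2 := fun ξ =>
    hFm.comp (f := fun p : ℝ × ℝ => ((p.1, ξ), p.2)) (by fun_prop)
  calc _ ≤ ∫⁻ t in Set.Icc (0:ℝ) T, ∫⁻ ξ : EuclideanSpace ℝ (Fin d),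
            ∫⁻ s in Icc (0:ℝ) T, F t ξ s := by
        refine setLIntegral_mono' measurableSet_Icc fun t ht => lintegral_mono fun ξ => ?_
        have hp := duh_pt T (L ξ) K (hL ξ) hK (fun u => A u ξ) (fun s => w s ξ) (hInt ξ)
          (fun u hu => by
            have h1 := hgard u hu ξ
            have h2 := hY _ (hg1 ξ)
            simp only [L]
            linarith) (hwm.comp (f := fun s => (s, ξ)) (by fun_prop)) t ht
        have hm1 : Measurable fun s => ‖w s ξ‖ₑ ^ 2 * duhK (L ξ) (t - s) :=
          ((hwm.comp (f := fun s => (s, ξ)) (by fun_prop)).enorm.pow_const 2).mul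
            (duhK_meas.comp (f := fun s : ℝ => (L ξ, t - s)) (by fun_prop))
        simp only [F]
        rw [lintegral_const_mul _ hm1, ENNReal.ofReal_mul (Real.rpow_pos_of_pos (hgp ξ) _).le,
          ENNReal.ofReal_pow (norm_nonneg _), ofReal_norm]
        simp only [P, mul_assoc]
        gcongr
    _ = ∫⁻ ξ : EuclideanSpace ℝ (Fin d), ∫⁻ t in Set.Icc (0:ℝ) T,
            ∫⁻ s in Icc (0:ℝ) T, F t ξ s := by
        rw [lintegral_lintegral_swap]
        exact (Measurable.lintegral_prod_right' hFm).aemeasurable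
    _ = ∫⁻ ξ : EuclideanSpace ℝ (Fin d), ∫⁻ s in Set.Icc (0:ℝ) T,
            ∫⁻ t in Icc (0:ℝ) T, F t ξ s := by
        refine lintegral_congr fun ξ => ?_
        rw [lintegral_lintegral_swap]
        exact (hFsec ξ).aemeasurable
    _ ≤ ∫⁻ ξ : EuclideanSpace ℝ (Fin d), ∫⁻ s in Set.Icc (0:ℝ) T,
            ENNReal.ofReal (Real.exp (2 * K * T) * (4 / G ^ 2)) *
              ENNReal.ofReal ((1 + ‖ξ‖) ^ ((m - 1) * α) * ‖w s ξ‖ ^ 2) := by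
        refine lintegral_mono fun ξ => lintegral_mono fun s => ?_
        have hkm : Measurable fun t => duhK (L ξ) (t - s) :=
          duhK_meas.comp (f := fun t : ℝ => (L ξ, t - s)) (by fun_prop)
        have hk : ∫⁻ t in Icc (0:ℝ) T, duhK (L ξ) (t - s) ≤ ENNReal.ofReal (1 / L ξ) := by
          rw [← duhK_int _ (hL ξ), ← lintegral_sub_right_eq_self (duhK (L ξ)) s]
          exact setLIntegral_le_lintegral _ _
        simp only [F]
        rw [lintegral_const_mul _ (by fun_prop), lintegral_const_mul _ hkm]
        calc _ ≤ P ξ * (‖w s ξ‖ₑ ^ 2 * ENNReal.ofReal (1 / L ξ)) := by gcongr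
          _ ≤ _ := by
            have hLp := hL ξ
            have hx : 0 < (1 + ‖ξ‖) ^ (m * α) := Real.rpow_pos_of_pos (hgp ξ) _
            have hz : 1 ≤ (1 + ‖ξ‖) ^ α := Real.one_le_rpow (hg1 ξ) hα.1.le
            have hy : (1 + ‖ξ‖) ^ ((m - 1) * α) = (1 + ‖ξ‖) ^ (m * α) / (1 + ‖ξ‖) ^ α := by
              rw [← Real.rpow_sub (hgp ξ)]; congr 1; ring
            simp only [P, E]
            rw [← ofReal_norm, ← ENNReal.ofReal_pow (norm_nonneg _),
              ← ENNReal.ofReal_mul (by positivity), ← ENNReal.ofReal_mul (by positivity),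
              ← ENNReal.ofReal_mul (by positivity), ← ENNReal.ofReal_mul (by positivity),
              ← ENNReal.ofReal_mul (by positivity)]
            apply ENNReal.ofReal_le_ofReal
            rw [hy]
            simp only [L]
            generalize (1 + ‖ξ‖) ^ (m * α) = x at *
            generalize (1 + ‖ξ‖) ^ α = z at *
            have hzp : 0 < z := by linarith
            have e1 : x * (Real.exp (2 * K * T) * (1 / (G / 2 * z))) *
                (‖w s ξ‖ ^ 2 * (1 / (G / 2 * z))) =
                (Real.exp (2 * K * T) * (4 / G ^ 2) * (x / z * ‖w s ξ‖ ^ 2)) * (1 / z) := by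
              field_simp
              ring
            rw [e1]
            apply mul_le_of_le_one_right (by positivity)
            rw [div_le_one hzp]; exact hz
    _ = ∫⁻ s in Set.Icc (0:ℝ) T, ∫⁻ ξ : EuclideanSpace ℝ (Fin d),
            ENNReal.ofReal (Real.exp (2 * K * T) * (4 / G ^ 2)) *
              ENNReal.ofReal ((1 + ‖ξ‖) ^ ((m - 1) * α) * ‖w s ξ‖ ^ 2) := by
        rw [lintegral_lintegral_swap]
        have h1 : Measurable fun p : EuclideanSpace ℝ (Fin d) × ℝ => w p.2 p.1 :=
          hwm.comp (f := fun p : EuclideanSpace ℝ (Fin d) × ℝ => (p.2, p.1)) (by fun_prop)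
        unfold Function.uncurry
        exact Measurable.aemeasurable (by fun_prop)
    _ = _ := by
        simp_rw [lintegral_const_mul' _ _ ENNReal.ofReal_ne_top]
end
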